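/- Let K ⊆ ℂⁿ be compact and let Γ ⊆ ℂⁿ be a compact polynomially convex set with trc(K) ⊆ Γ ⊆ K. Then K is polynomially convex. -/

import Mathlib

noncomputable section

/-- The polynomial hull of a set `K ⊆ ℂⁿ`: all points `z` with
`|P(z)| ≤ sup_{w ∈ K} |P(w)|` for every holomorphic polynomial `P` in `n` variables. -/
def polyHull (n : ℕ) (K : Set (Fin n → ℂ)) : Set (Fin n → ℂ) :=
  {z | ∀ P : MvPolynomial (Fin n) ℂ,
    ‖MvPolynomial.eval z P‖ ≤ sSup ((fun w => ‖MvPolynomial.eval w P‖) '' K)}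

/-- The essential hull `ess(K) = closure(K̂ \ K)`. -/
def essHull (n : ℕ) (K : Set (Fin n → ℂ)) : Set (Fin n → ℂ) :=
  closure (polyHull n K \ K)

/-- The trace `trc(K) = ess(K) ∩ K`. -/
def trc (n : ℕ) (K : Set (Fin n → ℂ)) : Set (Fin n → ℂ) :=
  essHull n K ∩ K

open MeasureTheory Complex ComplexConjugate Filter Topology
open scoped ContDiff

/-- The Wirtinger derivative `∂/∂z̄_j`. -/
def dbar {n : ℕ} (j : Fin n) (f : (Fin n → ℂ) → ℂ) (x : Fin n → ℂ) : ℂ :=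
  (1 / 2 : ℂ) * (fderiv ℝ f x (Pi.single j 1) + I * fderiv ℝ f x (Pi.single j I))

/-- The Wirtinger derivative `∂/∂z_j`. -/
def dee {n : ℕ} (j : Fin n) (f : (Fin n → ℂ) → ℂ) (x : Fin n → ℂ) : ℂ :=
  (1 / 2 : ℂ) * (fderiv ℝ f x (Pi.single j 1) - I * fderiv ℝ f x (Pi.single j I))

section Wirtinger

variable {n : ℕ} {f g : (Fin n → ℂ) → ℂ} {x : Fin n → ℂ}

lemma fderiv_apply_contDiff (hf : ContDiff ℝ ∞ f) (v : Fin n → ℂ) :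
    ContDiff ℝ ∞ (fun x => fderiv ℝ f x v) :=
  (hf.fderiv_right (m := ∞) (by simp)).clm_apply contDiff_const

lemma dbar_contDiff (hf : ContDiff ℝ ∞ f) (j : Fin n) : ContDiff ℝ ∞ (dbar j f) :=
  contDiff_const.mul ((fderiv_apply_contDiff hf _).add
    (contDiff_const.mul (fderiv_apply_contDiff hf _)))

lemma dee_contDiff (hf : ContDiff ℝ ∞ f) (j : Fin n) : ContDiff ℝ ∞ (dee j f) :=
  contDiff_const.mul ((fderiv_apply_contDiff hf _).sub
    (contDiff_const.mul (fderiv_apply_contDiff hf _)))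

lemma ContDiff.diffAt (hf : ContDiff ℝ ∞ f) (x : Fin n → ℂ) : DifferentiableAt ℝ f x :=
  (hf.differentiable (by simp)) x

lemma tsupport_dbar_subset (j : Fin n) : tsupport (dbar j f) ⊆ tsupport f := by
  refine closure_minimal (fun x hx => ?_) (isClosed_tsupport f)
  by_contra h
  apply hx
  have : fderiv ℝ f x = 0 := by
    by_contra h'
    exact h (support_fderiv_subset ℝ (f := f) h')
  simp [dbar, this]

lemma tsupport_dee_subset (j : Fin n) : tsupport (dee j f) ⊆ tsupport f := by
  refine closure_minimal (fun x hx => ?_) (isClosed_tsupport f)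
  by_contra h
  apply hx
  have : fderiv ℝ f x = 0 := by
    by_contra h'
    exact h (support_fderiv_subset ℝ (f := f) h')
  simp [dee, this]

lemma dbar_compact (hf : HasCompactSupport f) (j : Fin n) : HasCompactSupport (dbar j f) :=
  hf.mono' ((subset_tsupport _).trans (tsupport_dbar_subset j))

lemma dee_compact (hf : HasCompactSupport f) (j : Fin n) : HasCompactSupport (dee j f) :=
  hf.mono' ((subset_tsupport _).trans (tsupport_dee_subset j))

lemma dbar_add (hf : ContDiff ℝ ∞ f) (hg : ContDiff ℝ ∞ g) (j : Fin n) :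
    dbar j (fun x => f x + g x) x = dbar j f x + dbar j g x := by
  simp only [dbar, fderiv_fun_add (hf.diffAt x) (hg.diffAt x), add_apply]
  ring

lemma dee_add (hf : ContDiff ℝ ∞ f) (hg : ContDiff ℝ ∞ g) (j : Fin n) :
    dee j (fun x => f x + g x) x = dee j f x + dee j g x := by
  simp only [dee, fderiv_fun_add (hf.diffAt x) (hg.diffAt x), add_apply]
  ring

lemma dbar_neg (j : Fin n) : dbar j (fun x => - f x) x = - dbar j f x := by
  simp only [dbar, fderiv_fun_neg, neg_apply]
  ring

lemma dbar_mul (hf : ContDiff ℝ ∞ f) (hg : ContDiff ℝ ∞ g) (j : Fin n) :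
    dbar j (fun x => f x * g x) x = dbar j f x * g x + f x * dbar j g x := by
  simp only [dbar, fderiv_fun_mul (hf.diffAt x) (hg.diffAt x), add_apply,
    smul_apply, smul_eq_mul]
  ring

lemma dee_mul (hf : ContDiff ℝ ∞ f) (hg : ContDiff ℝ ∞ g) (j : Fin n) :
    dee j (fun x => f x * g x) x = dee j f x * g x + f x * dee j g x := by
  simp only [dee, fderiv_fun_mul (hf.diffAt x) (hg.diffAt x), add_apply,
    smul_apply, smul_eq_mul]
  ring

lemma dbar_const (c : ℂ) (j : Fin n) : dbar j (fun _ => c) x = 0 := by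
  simp [dbar]

lemma dee_const (c : ℂ) (j : Fin n) : dee j (fun _ => c) x = 0 := by
  simp [dee]

lemma dbar_sum {ι : Type*} (s : Finset ι) {f : ι → (Fin n → ℂ) → ℂ}
    (hf : ∀ i ∈ s, ContDiff ℝ ∞ (f i)) (j : Fin n) :
    dbar j (fun x => ∑ i ∈ s, f i x) x = ∑ i ∈ s, dbar j (f i) x := by
  simp only [dbar, fderiv_fun_sum (fun i hi => (hf i hi).diffAt x), sum_apply,
    Finset.mul_sum, ← Finset.sum_add_distrib]

lemma dee_sum {ι : Type*} (s : Finset ι) {f : ι → (Fin n → ℂ) → ℂ}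
    (hf : ∀ i ∈ s, ContDiff ℝ ∞ (f i)) (j : Fin n) :
    dee j (fun x => ∑ i ∈ s, f i x) x = ∑ i ∈ s, dee j (f i) x := by
  simp only [dee, fderiv_fun_sum (fun i hi => (hf i hi).diffAt x), sum_apply,
    Finset.mul_sum, ← Finset.sum_sub_distrib]

lemma contDiff_conj (hf : ContDiff ℝ ∞ f) : ContDiff ℝ ∞ (fun x => conj (f x)) :=
  conjCLE.contDiff.comp hf

lemma fderiv_conj_apply (hf : ContDiff ℝ ∞ f) (v : Fin n → ℂ) :
    fderiv ℝ (fun x => conj (f x)) x v = conj (fderiv ℝ f x v) := by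
  have : HasFDerivAt (fun x => conj (f x))
      ((conjCLE : ℂ →L[ℝ] ℂ).comp (fderiv ℝ f x)) x :=
    (conjCLE : ℂ →L[ℝ] ℂ).hasFDerivAt.comp x (hf.diffAt x).hasFDerivAt
  rw [this.fderiv]; simp

lemma dbar_conj (hf : ContDiff ℝ ∞ f) (j : Fin n) :
    dbar j (fun x => conj (f x)) x = conj (dee j f x) := by
  simp only [dbar, dee, fderiv_conj_apply hf]
  simp [conj_ofNat]

lemma dee_conj (hf : ContDiff ℝ ∞ f) (j : Fin n) :
    dee j (fun x => conj (f x)) x = conj (dbar j f x) := by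
  simp only [dbar, dee, fderiv_conj_apply hf]
  simp [sub_eq_add_neg, conj_ofNat]

lemma fderiv_fderiv_comm (hf : ContDiff ℝ ∞ f) (v w : Fin n → ℂ) :
    fderiv ℝ (fun y => fderiv ℝ f y v) x w = fderiv ℝ (fun y => fderiv ℝ f y w) x v := by
  have h1 : DifferentiableAt ℝ (fderiv ℝ f) x :=
    ((hf.fderiv_right (m := ∞) (by simp)).differentiable (by simp)) x
  rw [fderiv_clm_apply h1 (by fun_prop), fderiv_clm_apply h1 (by fun_prop)]
  have hs : IsSymmSndFDerivAt ℝ f x := hf.contDiffAt.isSymmSndFDerivAt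
    (by simp only [minSmoothness_of_isRCLikeNormedField]; exact ENat.LEInfty.out)
  simpa using hs w v

lemma fderiv_dbar (hf : ContDiff ℝ ∞ f) (j : Fin n) (v : Fin n → ℂ) :
    fderiv ℝ (dbar j f) x v = (1 / 2 : ℂ) * (fderiv ℝ (fun y => fderiv ℝ f y (Pi.single j 1)) x v
      + I * fderiv ℝ (fun y => fderiv ℝ f y (Pi.single j I)) x v) := by
  have h1 := (fderiv_apply_contDiff hf (Pi.single j 1)).diffAt x
  have h2 := (fderiv_apply_contDiff hf (Pi.single j I)).diffAt x
  have h3 : HasFDerivAt (dbar j f) _ x :=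
    (h1.hasFDerivAt.add (h2.hasFDerivAt.const_mul I)).const_mul (1 / 2 : ℂ)
  rw [h3.fderiv]
  simp [mul_add]

lemma fderiv_dee (hf : ContDiff ℝ ∞ f) (j : Fin n) (v : Fin n → ℂ) :
    fderiv ℝ (dee j f) x v = (1 / 2 : ℂ) * (fderiv ℝ (fun y => fderiv ℝ f y (Pi.single j 1)) x v
      - I * fderiv ℝ (fun y => fderiv ℝ f y (Pi.single j I)) x v) := by
  have h1 := (fderiv_apply_contDiff hf (Pi.single j 1)).diffAt x
  have h2 := (fderiv_apply_contDiff hf (Pi.single j I)).diffAt x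
  have h3 : HasFDerivAt (dee j f) _ x :=
    (h1.hasFDerivAt.sub (h2.hasFDerivAt.const_mul I)).const_mul (1 / 2 : ℂ)
  rw [h3.fderiv]
  simp [mul_sub]

lemma dbar_dbar_comm (hf : ContDiff ℝ ∞ f) (j k : Fin n) :
    dbar j (dbar k f) x = dbar k (dbar j f) x := by
  rw [dbar, dbar]
  simp only [fderiv_dbar hf]
  rw [fderiv_fderiv_comm hf (Pi.single k 1) (Pi.single j 1),
    fderiv_fderiv_comm hf (Pi.single k 1) (Pi.single j I),
    fderiv_fderiv_comm hf (Pi.single k I) (Pi.single j 1),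
    fderiv_fderiv_comm hf (Pi.single k I) (Pi.single j I)]
  ring

lemma dbar_dee_comm (hf : ContDiff ℝ ∞ f) (j k : Fin n) :
    dbar j (dee k f) x = dee k (dbar j f) x := by
  rw [dbar, dee]
  simp only [fderiv_dbar hf, fderiv_dee hf]
  rw [fderiv_fderiv_comm hf (Pi.single k 1) (Pi.single j 1),
    fderiv_fderiv_comm hf (Pi.single k 1) (Pi.single j I),
    fderiv_fderiv_comm hf (Pi.single k I) (Pi.single j 1),
    fderiv_fderiv_comm hf (Pi.single k I) (Pi.single j I)]
  ring

lemma integral_mul_fderiv_neg (hf : ContDiff ℝ ∞ f) (hg : ContDiff ℝ ∞ g)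
    (hc : HasCompactSupport f) (v : Fin n → ℂ) :
    ∫ x, f x * fderiv ℝ g x v = - ∫ x, fderiv ℝ f x v * g x := by
  have hf' := fderiv_apply_contDiff hf v
  have hg' := fderiv_apply_contDiff hg v
  have hc' : HasCompactSupport (fun x => fderiv ℝ f x v) := hc.fderiv_apply ℝ v
  apply integral_mul_fderiv_eq_neg_fderiv_mul_of_integrable
  · exact (hf'.continuous.mul hg.continuous).integrable_of_hasCompactSupport hc'.mul_right
  · exact (hf.continuous.mul hg'.continuous).integrable_of_hasCompactSupport hc.mul_right
  · exact (hf.continuous.mul hg.continuous).integrable_of_hasCompactSupport hc.mul_right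
  · exact fun x _ => hf.diffAt x
  · exact fun x _ => hg.diffAt x

lemma integral_mul_dbar (hf : ContDiff ℝ ∞ f) (hg : ContDiff ℝ ∞ g)
    (hc : HasCompactSupport f) (j : Fin n) :
    ∫ x, f x * dbar j g x = - ∫ x, dbar j f x * g x := by
  have key : ∀ v, Integrable (fun x => f x * fderiv ℝ g x v) := fun v =>
    (hf.continuous.mul (fderiv_apply_contDiff hg v).continuous).integrable_of_hasCompactSupport
      hc.mul_right
  have key' : ∀ v, Integrable (fun x => fderiv ℝ f x v * g x) := fun v =>
    ((fderiv_apply_contDiff hf v).continuous.mul hg.continuous).integrable_of_hasCompactSupport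
      (hc.fderiv_apply ℝ v).mul_right
  have e1 : ∀ x, f x * dbar j g x = (1 / 2 : ℂ) * (f x * fderiv ℝ g x (Pi.single j 1)) +
      (1 / 2 : ℂ) * (I * (f x * fderiv ℝ g x (Pi.single j I))) := fun x => by
    rw [dbar]; ring
  have e2 : ∀ x, dbar j f x * g x = (1 / 2 : ℂ) * (fderiv ℝ f x (Pi.single j 1) * g x) +
      (1 / 2 : ℂ) * (I * (fderiv ℝ f x (Pi.single j I) * g x)) := fun x => by
    rw [dbar]; ring
  simp only [e1, e2]
  rw [integral_add ((key _).const_mul _) (((key _).const_mul _).const_mul _),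
    integral_add ((key' _).const_mul _) (((key' _).const_mul _).const_mul _)]
  simp only [integral_const_mul, integral_mul_fderiv_neg hf hg hc]
  ring

end Wirtinger

/-- Smooth compactly supported functions on `ℂⁿ`. -/
def IsTest {n : ℕ} (f : (Fin n → ℂ) → ℂ) : Prop := ContDiff ℝ ∞ f ∧ HasCompactSupport f

/-- The zeroth order coefficients `a_j = ∂φ/∂z̄_j / 2` coming from a strictly plurisubharmonic
weight `φ`, whose complex Hessian is at least the identity. -/
structure WeightCoeff (n : ℕ) where
  /-- The coefficients. -/
  a : Fin n → (Fin n → ℂ) → ℂ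
  smooth : ∀ j, ContDiff ℝ ∞ (a j)
  closed : ∀ j k x, dbar j (a k) x = dbar k (a j) x
  pos : ∀ x (c : Fin n → ℂ), ∑ j, ‖c j‖ ^ 2 ≤
    (∑ j, ∑ k, (dbar k (fun y => conj (a j y)) x + dee j (a k) x) * c j * conj (c k)).re

namespace WeightCoeff

variable {n : ℕ} (W : WeightCoeff n)

/-- The twisted Cauchy-Riemann operator. -/
def A (j : Fin n) (f : (Fin n → ℂ) → ℂ) (x : Fin n → ℂ) : ℂ := dbar j f x + W.a j x * f x

/-- The formal adjoint of the twisted Cauchy-Riemann operator. -/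
def B (j : Fin n) (f : (Fin n → ℂ) → ℂ) (x : Fin n → ℂ) : ℂ := conj (W.a j x) * f x - dee j f x

end WeightCoeff

section BasicEstimate

variable {n : ℕ} {W : WeightCoeff n} {f g : (Fin n → ℂ) → ℂ}

lemma IsTest.conj (hf : IsTest f) : IsTest (fun x => conj (f x)) :=
  ⟨contDiff_conj hf.1, hf.2.comp_left (map_zero _)⟩

lemma IsTest.dbar (hf : IsTest f) (j : Fin n) : IsTest (dbar j f) :=
  ⟨dbar_contDiff hf.1 j, dbar_compact hf.2 j⟩

lemma IsTest.dee (hf : IsTest f) (j : Fin n) : IsTest (dee j f) :=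
  ⟨dee_contDiff hf.1 j, dee_compact hf.2 j⟩

lemma IsTest.add (hf : IsTest f) (hg : IsTest g) : IsTest (fun x => f x + g x) :=
  ⟨hf.1.add hg.1, hf.2.add hg.2⟩

lemma IsTest.neg (hf : IsTest f) : IsTest (fun x => - f x) :=
  ⟨hf.1.neg, hf.2.neg⟩

lemma IsTest.sub (hf : IsTest f) (hg : IsTest g) : IsTest (fun x => f x - g x) := by
  simpa only [sub_eq_add_neg] using hf.add hg.neg

lemma IsTest.smooth_mul (hg : IsTest g) (hf : ContDiff ℝ ∞ f) : IsTest (fun x => f x * g x) :=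
  ⟨hf.mul hg.1, hg.2.mul_left⟩

lemma IsTest.zero : IsTest (fun _ : Fin n → ℂ => (0 : ℂ)) :=
  ⟨contDiff_const, HasCompactSupport.zero⟩

lemma IsTest.sum {ι : Type*} (s : Finset ι) {f : ι → (Fin n → ℂ) → ℂ}
    (hf : ∀ i ∈ s, IsTest (f i)) : IsTest (fun x => ∑ i ∈ s, f i x) := by
  classical
  induction s using Finset.induction_on with
  | empty => simpa using IsTest.zero
  | insert i s hi ih =>
    simp only [Finset.sum_insert hi]
    exact (hf i (by simp)).add (ih fun k hk => hf k (by simp [hk]))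

lemma IsTest.integrable (hf : IsTest f) : Integrable f :=
  hf.1.continuous.integrable_of_hasCompactSupport hf.2

lemma IsTest.memLp (hf : IsTest f) : MemLp f 2 :=
  hf.1.continuous.memLp_of_hasCompactSupport hf.2

lemma IsTest.A (hf : IsTest f) (j : Fin n) : IsTest (W.A j f) :=
  (hf.dbar j).add (hf.smooth_mul (W.smooth j))

lemma IsTest.B (hf : IsTest f) (j : Fin n) : IsTest (W.B j f) :=
  (hf.smooth_mul (contDiff_conj (W.smooth j))).sub (hf.dee j)

lemma integral_mul_dee (hf : ContDiff ℝ ∞ f) (hg : ContDiff ℝ ∞ g)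
    (hc : HasCompactSupport f) (j : Fin n) :
    ∫ x, f x * dee j g x = - ∫ x, dee j f x * g x := by
  have h := integral_mul_dbar (contDiff_conj hf) (contDiff_conj hg)
    (hc.comp_left (g := conj) (map_zero _)) j
  simp only [dbar_conj hf, dbar_conj hg] at h
  simp only [← map_mul, integral_conj] at h
  simpa using congrArg conj h

/-- `B j` is the formal adjoint of `A j`. -/
lemma integral_conj_A_mul (hf : IsTest f) (hg : IsTest g) (j : Fin n) :
    ∫ x, conj (W.A j f x) * g x = ∫ x, conj (f x) * W.B j g x := by
  have h := integral_mul_dee hf.conj.1 hg.1 hf.conj.2 j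
  have e1 : ∀ x, conj (W.A j f x) * g x =
      dee j (fun y => conj (f y)) x * g x + conj (f x) * (conj (W.a j x) * g x) := fun x => by
    rw [WeightCoeff.A, dee_conj hf.1, map_add, map_mul]; ring
  have e2 : ∀ x, conj (f x) * W.B j g x =
      - (conj (f x) * dee j g x) + conj (f x) * (conj (W.a j x) * g x) := fun x => by
    rw [WeightCoeff.B]; ring
  simp only [e1, e2]
  have i1 : IsTest (fun x => conj (f x) * (conj (W.a j x) * g x)) :=
    (hg.smooth_mul (contDiff_conj (W.smooth j))).smooth_mul hf.conj.1
  have i2 : IsTest (fun x => dee j (fun y => conj (f y)) x * g x) :=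
    hg.smooth_mul (hf.conj.dee j).1
  have i3 : IsTest (fun x => conj (f x) * dee j g x) := (hg.dee j).smooth_mul hf.conj.1
  rw [integral_add i2.integrable i1.integrable,
    integral_add i3.neg.integrable i1.integrable, integral_neg, h]
  ring

lemma integral_conj_B_mul (hf : IsTest f) (hg : IsTest g) (j : Fin n) :
    ∫ x, conj (W.B j f x) * g x = ∫ x, conj (f x) * W.A j g x := by
  have h := congrArg conj (integral_conj_A_mul (W := W) hg hf j)
  simp only [← integral_conj, map_mul, conj_conj] at h
  simp only [mul_comm (conj _) _]
  exact h.symm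

lemma A_B_comm (hf : IsTest f) (j k : Fin n) (x : Fin n → ℂ) :
    W.A k (W.B j f) x = W.B j (W.A k f) x +
      (dbar k (fun y => conj (W.a j y)) x + dee j (W.a k) x) * f x := by
  have h1 : dbar k (W.B j f) x = dbar k (fun y => conj (W.a j y)) x * f x
      + conj (W.a j x) * dbar k f x - dbar k (dee j f) x := by
    have : W.B j f = fun x => conj (W.a j x) * f x + - dee j f x := by
      funext x; simp [WeightCoeff.B, sub_eq_add_neg]
    rw [this, dbar_add ((contDiff_conj (W.smooth j)).mul hf.1) (hf.dee j).neg.1, dbar_neg,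
      dbar_mul (contDiff_conj (W.smooth j)) hf.1]
    ring
  have h2 : dee j (W.A k f) x = dee j (dbar k f) x + (dee j (W.a k) x * f x +
      W.a k x * dee j f x) := by
    unfold WeightCoeff.A
    rw [dee_add (hf.dbar k).1 ((W.smooth k).mul hf.1), dee_mul (W.smooth k) hf.1]
  rw [WeightCoeff.A, h1, WeightCoeff.B, WeightCoeff.B, h2, WeightCoeff.A, dbar_dee_comm hf.1]
  ring

lemma A_A_comm (hf : IsTest f) (j k : Fin n) (x : Fin n → ℂ) :
    W.A k (W.A j f) x = W.A j (W.A k f) x := by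
  have h : ∀ j k, dbar k (W.A j f) x = dbar k (dbar j f) x + (dbar k (W.a j) x * f x +
      W.a j x * dbar k f x) := fun j k => by
    unfold WeightCoeff.A
    rw [dbar_add (hf.dbar j).1 ((W.smooth j).mul hf.1), dbar_mul (W.smooth j) hf.1]
  rw [WeightCoeff.A, h, WeightCoeff.A, WeightCoeff.A, h, WeightCoeff.A, dbar_dbar_comm hf.1,
    W.closed k j]
  ring

lemma re_sum_conj_mul_swap {n : ℕ} (X : Fin n → Fin n → ℂ) :
    - ∑ j, ∑ k, ‖X j k - X k j‖ ^ 2 ≤ (∑ j, ∑ k, conj (X j k) * X k j).re := by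
  have h : ∀ j k, ‖X j k - X k j‖ ^ 2 =
      ‖X j k‖ ^ 2 + ‖X k j‖ ^ 2 - 2 * (conj (X j k) * X k j).re := fun j k => by
    simp only [← normSq_eq_norm_sq, normSq_sub, mul_re, conj_re, conj_im]
    ring
  have hs : ∑ j, ∑ k, ‖X k j‖ ^ 2 = ∑ j, ∑ k, ‖X j k‖ ^ 2 := Finset.sum_comm
  have hp : 0 ≤ ∑ j, ∑ k, ‖X j k‖ ^ 2 := by positivity
  have hq : 0 ≤ ∑ j, ∑ k, ‖X j k - X k j‖ ^ 2 := by positivity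
  have key : ∑ j, ∑ k, ‖X j k - X k j‖ ^ 2 = ∑ j, ∑ k, ‖X j k‖ ^ 2 + ∑ j, ∑ k, ‖X j k‖ ^ 2
      - 2 * (∑ j, ∑ k, conj (X j k) * X k j).re := by
    simp only [h, Finset.sum_sub_distrib, Finset.sum_add_distrib, hs, ← Finset.mul_sum, re_sum]
  linarith

lemma IsTest.integrable_sq (hf : IsTest f) : Integrable (fun x => ‖f x‖ ^ 2) := by
  have hc : Continuous fun x => ‖f x‖ ^ 2 := hf.1.continuous.norm.pow 2
  refine hc.integrable_of_hasCompactSupport ?_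
  exact hf.2.comp_left (g := fun z : ℂ => ‖z‖ ^ 2) (by simp)

/-- The Kohn-Morrey-Hörmander estimate for smooth compactly supported `(0,1)`-forms. -/
theorem basic_estimate (W : WeightCoeff n) {g : Fin n → (Fin n → ℂ) → ℂ}
    (hg : ∀ j, IsTest (g j)) :
    ∑ j, ∫ x, ‖g j x‖ ^ 2 ≤ (∫ x, ‖∑ j, W.B j (g j) x‖ ^ 2) +
      ∑ j, ∑ k, ∫ x, ‖W.A k (g j) x - W.A j (g k) x‖ ^ 2 := by
  let M : Fin n → Fin n → (Fin n → ℂ) → ℂ := fun j k x =>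
    dbar k (fun y => conj (W.a j y)) x + dee j (W.a k) x
  have hM : ∀ j k, ContDiff ℝ ∞ (M j k) := fun j k =>
    (dbar_contDiff (contDiff_conj (W.smooth j)) k).add (dee_contDiff (W.smooth k) j)
  have hB : IsTest (fun x => ∑ j, W.B j (g j) x) := IsTest.sum _ fun j _ => (hg j).B j
  have hBB : ∀ j k, IsTest (fun x => conj (W.B j (g j) x) * W.B k (g k) x) := fun j k =>
    ((hg k).B k).smooth_mul ((hg j).B j).conj.1
  have hAA : ∀ j k, IsTest (fun x => conj (W.A k (g j) x) * W.A j (g k) x) := fun j k =>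
    ((hg k).A j).smooth_mul ((hg j).A k).conj.1
  have hMM : ∀ j k, IsTest (fun x => M j k x * g j x * conj (g k x)) := fun j k =>
    (hg k).conj.smooth_mul ((hM j k).mul (hg j).1)
  have e0 : ((∫ x, ‖∑ j, W.B j (g j) x‖ ^ 2 : ℝ) : ℂ) =
      ∑ j, ∑ k, ∫ x, conj (W.B j (g j) x) * W.B k (g k) x := by
    rw [← integral_complex_ofReal]
    have : ∀ x, ((‖∑ j, W.B j (g j) x‖ ^ 2 : ℝ) : ℂ) =
        ∑ j, ∑ k, conj (W.B j (g j) x) * W.B k (g k) x := fun x => by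
      push_cast
      rw [← conj_mul', map_sum, Finset.sum_mul_sum]
    simp only [this]
    rw [integral_finsetSum _ fun j _ => integrable_finsetSum _ fun k _ => (hBB j k).integrable]
    refine Finset.sum_congr rfl fun j _ => ?_
    rw [integral_finsetSum _ fun k _ => (hBB j k).integrable]
  have e1 : ∀ j k, ∫ x, conj (W.B j (g j) x) * W.B k (g k) x =
      (∫ x, conj (W.A k (g j) x) * W.A j (g k) x) +
      conj (∫ x, M j k x * g j x * conj (g k x)) := fun j k => by
    rw [← integral_conj_A_mul ((hg j).B j) (hg k) k, ← integral_conj_B_mul ((hg j).A k) (hg k) j,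
      ← integral_conj, ← integral_add]
    · congr 1; funext x
      rw [A_B_comm (hg j)]
      simp only [M, map_add, map_mul, conj_conj]
      ring
    · exact ((hg k).smooth_mul (((hg j).A k).B j).conj.1).integrable
    · exact (hMM j k).conj.integrable
  have e2 : (∫ x, ‖∑ j, W.B j (g j) x‖ ^ 2) =
      (∫ x, (∑ j, ∑ k, conj (W.A k (g j) x) * W.A j (g k) x).re) +
      ∫ x, (∑ j, ∑ k, M j k x * g j x * conj (g k x)).re := by
    have r : ∀ F : (Fin n → ℂ) → ℂ, IsTest F → ∫ x, (F x).re = (∫ x, F x).re :=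
      fun F hF => integral_re hF.integrable
    rw [r _ (IsTest.sum _ fun j _ => IsTest.sum _ fun k _ => hAA j k),
      r _ (IsTest.sum _ fun j _ => IsTest.sum _ fun k _ => hMM j k),
      integral_finsetSum _ fun j _ => (IsTest.sum _ fun k _ => hAA j k).integrable,
      integral_finsetSum _ fun j _ => (IsTest.sum _ fun k _ => hMM j k).integrable]
    simp only [integral_finsetSum _ fun k _ => (hAA _ k).integrable,
      integral_finsetSum _ fun k _ => (hMM _ k).integrable]
    have := congrArg re e0
    simp only [e1, Finset.sum_add_distrib, add_re, ofReal_re] at this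
    rw [this]
    simp [re_sum]
  have i1 : Integrable (fun x => (∑ j, ∑ k, M j k x * g j x * conj (g k x)).re) :=
    (IsTest.sum _ fun j _ => IsTest.sum _ fun k _ => hMM j k).integrable.re
  have i2 : Integrable (fun x => (∑ j, ∑ k, conj (W.A k (g j) x) * W.A j (g k) x).re) :=
    (IsTest.sum _ fun j _ => IsTest.sum _ fun k _ => hAA j k).integrable.re
  have i3 : ∀ j k, Integrable (fun x => ‖W.A k (g j) x - W.A j (g k) x‖ ^ 2) := fun j k =>
    (((hg j).A k).sub ((hg k).A j)).integrable_sq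
  have b1 : ∑ j, ∫ x, ‖g j x‖ ^ 2 ≤ ∫ x, (∑ j, ∑ k, M j k x * g j x * conj (g k x)).re := by
    rw [← integral_finsetSum _ fun j _ => (hg j).integrable_sq]
    exact integral_mono (integrable_finsetSum _ fun j _ => (hg j).integrable_sq) i1
      fun x => W.pos x fun j => g j x
  have b2 : - ∑ j, ∑ k, ∫ x, ‖W.A k (g j) x - W.A j (g k) x‖ ^ 2 ≤
      ∫ x, (∑ j, ∑ k, conj (W.A k (g j) x) * W.A j (g k) x).re := by
    simp only [← integral_finsetSum _ fun k _ => i3 _ k]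
    rw [← integral_finsetSum _ fun j _ => integrable_finsetSum _ fun k _ => i3 j k,
      ← integral_neg]
    exact integral_mono (integrable_finsetSum _ fun j _ =>
      integrable_finsetSum _ fun k _ => i3 j k).neg i2
      fun x => re_sum_conj_mul_swap fun j k => W.A k (g j) x
  linarith

end BasicEstimate

open scoped ENNReal NNReal

section Mollification

variable {n : ℕ} {W : WeightCoeff n} {ρ g : (Fin n → ℂ) → ℂ}

/-- Convolution of a function `g` with a kernel `ρ`. -/
def conv (ρ g : (Fin n → ℂ) → ℂ) (x : Fin n → ℂ) : ℂ := ∫ y, g y * ρ (x - y)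

lemma conv_eq_convolution (ρ g : (Fin n → ℂ) → ℂ) :
    conv ρ g = MeasureTheory.convolution g ρ (ContinuousLinearMap.mul ℝ ℂ) volume := rfl

lemma conv_contDiff (hρ : IsTest ρ) (hg : LocallyIntegrable g) : ContDiff ℝ ∞ (conv ρ g) := by
  rw [conv_eq_convolution]
  exact hρ.2.contDiff_convolution_right _ hg hρ.1

lemma fderiv_conv (hρ : IsTest ρ) (hg : LocallyIntegrable g) (x v : Fin n → ℂ) :
    fderiv ℝ (conv ρ g) x v = conv (fun y => fderiv ℝ ρ y v) g x := by
  rw [conv_eq_convolution, conv_eq_convolution,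
    (hρ.2.hasFDerivAt_convolution_right (ContinuousLinearMap.mul ℝ ℂ) hg
      (hρ.1.of_le (by simp)) x).fderiv]
  exact convolution_precompR_apply _ hg (hρ.2.fderiv ℝ) (hρ.1.continuous_fderiv (by simp)) x v

lemma translate_isTest (hρ : IsTest ρ) (x : Fin n → ℂ) : IsTest (fun y => ρ (x - y)) :=
  ⟨hρ.1.comp (contDiff_const.sub contDiff_id),
    hρ.2.comp_homeomorph (Homeomorph.subLeft x)⟩

lemma integrable_conv (hρ : Continuous ρ) (hc : HasCompactSupport ρ) (hg : LocallyIntegrable g)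
    (x : Fin n → ℂ) : Integrable (fun y => g y * ρ (x - y)) := by
  have h1 : HasCompactSupport (fun y => ρ (x - y)) := hc.comp_homeomorph (Homeomorph.subLeft x)
  have h2 : Continuous fun y => ρ (x - y) := hρ.comp (continuous_const.sub continuous_id)
  simpa only [smul_eq_mul, mul_comm] using hg.integrable_smul_right_of_hasCompactSupport h2 h1

lemma dbar_conv (hρ : IsTest ρ) (hg : LocallyIntegrable g) (j : Fin n) (x : Fin n → ℂ) :
    dbar j (conv ρ g) x = conv (dbar j ρ) g x := by
  have hd : ∀ v, Integrable (fun y => g y * fderiv ℝ ρ (x - y) v) := fun v =>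
    integrable_conv (fderiv_apply_contDiff hρ.1 v).continuous (hρ.2.fderiv_apply ℝ v) hg x
  rw [dbar, fderiv_conv hρ hg, fderiv_conv hρ hg]
  unfold conv
  rw [← integral_const_mul, ← integral_add (hd _) ((hd _).const_mul _), ← integral_const_mul]
  congr 1; funext y; rw [dbar]; ring

lemma dee_conv (hρ : IsTest ρ) (hg : LocallyIntegrable g) (j : Fin n) (x : Fin n → ℂ) :
    dee j (conv ρ g) x = conv (dee j ρ) g x := by
  have hd : ∀ v, Integrable (fun y => g y * fderiv ℝ ρ (x - y) v) := fun v =>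
    integrable_conv (fderiv_apply_contDiff hρ.1 v).continuous (hρ.2.fderiv_apply ℝ v) hg x
  rw [dee, fderiv_conv hρ hg, fderiv_conv hρ hg]
  unfold conv
  rw [← integral_const_mul, ← integral_sub (hd _) ((hd _).const_mul _), ← integral_const_mul]
  congr 1; funext y; rw [dee]; ring

lemma fderiv_translate (hρ : IsTest ρ) (x y v : Fin n → ℂ) :
    fderiv ℝ (fun y => ρ (x - y)) y v = - fderiv ℝ ρ (x - y) v := by
  have h := (hρ.1.diffAt (x - y)).hasFDerivAt.comp y ((hasFDerivAt_id y).const_sub x)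
  have h' : HasFDerivAt (fun y => ρ (x - y)) _ y := h
  rw [h'.fderiv]; simp

lemma dbar_translate (hρ : IsTest ρ) (j : Fin n) (x y : Fin n → ℂ) :
    dbar j (fun y => ρ (x - y)) y = - dbar j ρ (x - y) := by
  simp only [dbar, fderiv_translate hρ]; ring

lemma dee_translate (hρ : IsTest ρ) (j : Fin n) (x y : Fin n → ℂ) :
    dee j (fun y => ρ (x - y)) y = - dee j ρ (x - y) := by
  simp only [dee, fderiv_translate hρ]; ring

/-- The commutator of multiplication by `a` and convolution with `ρ`. -/
def convComm (a ρ g : (Fin n → ℂ) → ℂ) (x : Fin n → ℂ) : ℂ :=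
  ∫ y, g y * ((a x - a y) * ρ (x - y))

lemma integrable_convComm {a : (Fin n → ℂ) → ℂ} (ha : ContDiff ℝ ∞ a) (hρ : IsTest ρ)
    (hg : LocallyIntegrable g) (x : Fin n → ℂ) :
    Integrable (fun y => g y * ((a x - a y) * ρ (x - y))) := by
  have h1 : IsTest (fun y => (a x - a y) * ρ (x - y)) :=
    (translate_isTest hρ x).smooth_mul (contDiff_const.sub ha)
  simpa only [smul_eq_mul, mul_comm] using
    hg.integrable_smul_right_of_hasCompactSupport h1.1.continuous h1.2

lemma A_conv (hρ : IsTest ρ) (hr : ∀ x, conj (ρ x) = ρ x) (hg : LocallyIntegrable g)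
    (k : Fin n) (x : Fin n → ℂ) :
    W.A k (conv ρ g) x =
      (∫ y, conj (W.B k (fun y => ρ (x - y)) y) * g y) + convComm (W.a k) ρ g x := by
  have hd : ∀ z, conj (dee k ρ z) = dbar k ρ z := fun z => by
    rw [← dbar_conj hρ.1]; simp only [hr]
  have i1 := integrable_conv (hρ.dbar k).1.continuous (hρ.dbar k).2 hg x
  have i2 := integrable_conv hρ.1.continuous hρ.2 hg x
  have i3 := integrable_convComm (W.smooth k) hρ hg x
  have e : ∀ y, conj (W.B k (fun y => ρ (x - y)) y) * g y =
      (g y * dbar k ρ (x - y) + W.a k x * (g y * ρ (x - y))) -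
        g y * ((W.a k x - W.a k y) * ρ (x - y)) := fun y => by
    simp only [WeightCoeff.B, dee_translate hρ, map_sub, map_mul, map_neg, conj_conj, hd, hr]
    ring
  simp only [e]
  have i12 : Integrable (fun y => g y * dbar k ρ (x - y) + W.a k x * (g y * ρ (x - y))) :=
    i1.add (i2.const_mul _)
  rw [integral_sub i12 i3, integral_add i1 (i2.const_mul _),
    integral_const_mul, WeightCoeff.A, dbar_conv hρ hg]
  unfold conv convComm
  ring

lemma B_conv (hρ : IsTest ρ) (hr : ∀ x, conj (ρ x) = ρ x) (hg : LocallyIntegrable g)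
    (k : Fin n) (x : Fin n → ℂ) :
    W.B k (conv ρ g) x =
      (∫ y, conj (W.A k (fun y => ρ (x - y)) y) * g y) +
        convComm (fun y => conj (W.a k y)) ρ g x := by
  have hd : ∀ z, conj (dbar k ρ z) = dee k ρ z := fun z => by
    rw [← dee_conj hρ.1]; simp only [hr]
  have i1 := integrable_conv (hρ.dee k).1.continuous (hρ.dee k).2 hg x
  have i2 := integrable_conv hρ.1.continuous hρ.2 hg x
  have i3 := integrable_convComm (contDiff_conj (W.smooth k)) hρ hg x
  have e : ∀ y, conj (W.A k (fun y => ρ (x - y)) y) * g y =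
      (conj (W.a k x) * (g y * ρ (x - y)) - g y * dee k ρ (x - y)) -
        g y * ((conj (W.a k x) - conj (W.a k y)) * ρ (x - y)) := fun y => by
    simp only [WeightCoeff.A, dbar_translate hρ, map_add, map_mul, map_neg, hd, hr]
    ring
  simp only [e]
  have i12 : Integrable (fun y => conj (W.a k x) * (g y * ρ (x - y)) - g y * dee k ρ (x - y)) :=
    (i2.const_mul _).sub i1
  rw [integral_sub i12 i3, integral_sub (i2.const_mul _) i1,
    integral_const_mul, WeightCoeff.B, dee_conv hρ hg]
  unfold conv convComm
  ring

/-- Squared `L²` norm. -/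
def sqNorm (f : (Fin n → ℂ) → ℂ) : ℝ≥0∞ := ∫⁻ x, ‖f x‖ₑ ^ 2

lemma sqNorm_eq_ofReal (hf : IsTest g) : sqNorm g = ENNReal.ofReal (∫ x, ‖g x‖ ^ 2) := by
  rw [ofReal_integral_eq_lintegral_ofReal hf.integrable_sq (ae_of_all _ fun x => by positivity)]
  refine lintegral_congr fun x => ?_
  rw [← ofReal_norm, ENNReal.ofReal_pow (norm_nonneg _)]

lemma basic_estimate_sqNorm (W : WeightCoeff n) {g : Fin n → (Fin n → ℂ) → ℂ}
    (hg : ∀ j, IsTest (g j)) :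
    ∑ j, sqNorm (g j) ≤ sqNorm (fun x => ∑ j, W.B j (g j) x) +
      ∑ j, ∑ k, sqNorm (fun x => W.A k (g j) x - W.A j (g k) x) := by
  have h := basic_estimate W hg
  have hB : IsTest (fun x => ∑ j, W.B j (g j) x) := IsTest.sum _ fun j _ => (hg j).B j
  have hY : ∀ j k, IsTest (fun x => W.A k (g j) x - W.A j (g k) x) := fun j k =>
    ((hg j).A k).sub ((hg k).A j)
  have hp : ∀ f : (Fin n → ℂ) → ℂ, 0 ≤ ∫ x, ‖f x‖ ^ 2 := fun f =>
    integral_nonneg fun x => by positivity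
  simp only [sqNorm_eq_ofReal (hg _), sqNorm_eq_ofReal hB, sqNorm_eq_ofReal (hY _ _)]
  have e : ∀ j, ∑ k, ENNReal.ofReal (∫ x, ‖W.A k (g j) x - W.A j (g k) x‖ ^ 2) =
      ENNReal.ofReal (∑ k, ∫ x, ‖W.A k (g j) x - W.A j (g k) x‖ ^ 2) := fun j =>
    (ENNReal.ofReal_sum_of_nonneg fun k _ => hp _).symm
  simp only [e]
  rw [← ENNReal.ofReal_sum_of_nonneg fun j _ => hp _,
    ← ENNReal.ofReal_sum_of_nonneg fun j _ => Finset.sum_nonneg fun k _ => hp _,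
    ← ENNReal.ofReal_add (hp _) (Finset.sum_nonneg fun j _ => Finset.sum_nonneg fun k _ => hp _)]
  exact ENNReal.ofReal_le_ofReal h

/-- Convolution of the absolute values. -/
def absConv (ρ g : (Fin n → ℂ) → ℂ) (x : Fin n → ℂ) : ℝ≥0∞ := ∫⁻ y, ‖g y‖ₑ * ‖ρ (x - y)‖ₑ

lemma enorm_conv_le (x : Fin n → ℂ) : ‖conv ρ g x‖ₑ ≤ absConv ρ g x := by
  refine (enorm_integral_le_lintegral_enorm _).trans (lintegral_mono fun y => ?_)
  simp

lemma enorm_convComm_le {a : (Fin n → ℂ) → ℂ} {c : ℝ≥0∞} {x : Fin n → ℂ}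
    (hc : c ≠ ⊤) (h : ∀ y, ρ (x - y) ≠ 0 → ‖a x - a y‖ₑ ≤ c) :
    ‖convComm a ρ g x‖ₑ ≤ c * absConv ρ g x := by
  refine (enorm_integral_le_lintegral_enorm _).trans ?_
  rw [absConv, ← lintegral_const_mul' _ _ hc]
  refine lintegral_mono fun y => ?_
  by_cases h0 : ρ (x - y) = 0
  · simp [h0]
  · simp only [enorm_mul]
    calc ‖g y‖ₑ * (‖a x - a y‖ₑ * ‖ρ (x - y)‖ₑ) ≤ ‖g y‖ₑ * (c * ‖ρ (x - y)‖ₑ) := by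
          gcongr; exact h y h0
      _ = _ := by ring

/-- Young's inequality for convolution with a kernel of integral one. -/
lemma lintegral_absConv_sq_le (hρ : Continuous ρ) (h1 : ∫⁻ x, ‖ρ x‖ₑ = 1)
    (hg : AEStronglyMeasurable g volume) : ∫⁻ x, absConv ρ g x ^ 2 ≤ sqNorm g := by
  have hm : ∀ x, AEMeasurable (fun y => ‖ρ (x - y)‖ₑ) volume := fun x =>
    (hρ.comp (continuous_const.sub continuous_id)).enorm.aemeasurable
  have hT : ∀ x, ∫⁻ y, ‖ρ (x - y)‖ₑ = 1 := fun x => by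
    rw [lintegral_sub_left_eq_self (fun y => ‖ρ y‖ₑ) x, h1]
  have hsq : ∀ t : ℝ≥0∞, (t ^ (1 / 2 : ℝ)) ^ 2 = t := fun t => by
    rw [← ENNReal.rpow_natCast, ← ENNReal.rpow_mul]; norm_num
  have hsq' : ∀ t : ℝ≥0∞, (t ^ 2) ^ (1 / 2 : ℝ) = t := fun t => by
    rw [← ENNReal.rpow_natCast, ← ENNReal.rpow_mul]; norm_num
  have key : ∀ x, absConv ρ g x ^ 2 ≤ ∫⁻ y, ‖g y‖ₑ ^ 2 * ‖ρ (x - y)‖ₑ := fun x => by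
    have h := ENNReal.lintegral_mul_norm_pow_le (μ := volume)
      (f := fun y => ‖g y‖ₑ ^ 2 * ‖ρ (x - y)‖ₑ) (g := fun y => ‖ρ (x - y)‖ₑ)
      ((hg.enorm.pow_const 2).mul (hm x)) (hm x)
      (p := 1 / 2) (q := 1 / 2) (by norm_num) (by norm_num) (by norm_num)
    have e : ∀ y, (‖g y‖ₑ ^ 2 * ‖ρ (x - y)‖ₑ) ^ (1 / 2 : ℝ) * ‖ρ (x - y)‖ₑ ^ (1 / 2 : ℝ) =
        ‖g y‖ₑ * ‖ρ (x - y)‖ₑ := fun y => by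
      rw [ENNReal.mul_rpow_of_nonneg _ _ (by norm_num), hsq', mul_assoc, ← sq, hsq]
    simp only [e, hT, ENNReal.one_rpow, mul_one] at h
    calc absConv ρ g x ^ 2 ≤ ((∫⁻ y, ‖g y‖ₑ ^ 2 * ‖ρ (x - y)‖ₑ) ^ (1 / 2 : ℝ)) ^ 2 := by
          gcongr; exact h
      _ = _ := hsq _
  refine (lintegral_mono key).trans ?_
  rw [lintegral_lintegral_swap]
  · rw [sqNorm]
    refine lintegral_mono fun y => ?_
    rw [lintegral_const_mul' _ _ (by simp), lintegral_sub_right_eq_self (fun x => ‖ρ x‖ₑ) y, h1,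
      mul_one]
  · have m1 : AEMeasurable (fun p : (Fin n → ℂ) × (Fin n → ℂ) => ‖g p.2‖ₑ ^ 2)
        (volume.prod volume) :=
      (hg.enorm.pow_const 2).comp_quasiMeasurePreserving Measure.quasiMeasurePreserving_snd
    have m2 : AEMeasurable (fun p : (Fin n → ℂ) × (Fin n → ℂ) => ‖ρ (p.1 - p.2)‖ₑ)
        (volume.prod volume) :=
      (hρ.comp (continuous_fst.sub continuous_snd)).enorm.aemeasurable
    exact m1.mul m2

end Mollification

section Regularity

variable {n : ℕ} {W : WeightCoeff n}

lemma norm_dbar_le {f : (Fin n → ℂ) → ℂ} {x : Fin n → ℂ} {C : ℝ} (h : ‖fderiv ℝ f x‖ ≤ C)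
    (j : Fin n) : ‖dbar j f x‖ ≤ C := by
  have h1 : ‖fderiv ℝ f x (Pi.single j 1)‖ ≤ C := by
    refine (ContinuousLinearMap.le_opNorm _ _).trans ?_
    rw [Pi.norm_single]; simpa using h
  have h2 : ‖fderiv ℝ f x (Pi.single j I)‖ ≤ C := by
    refine (ContinuousLinearMap.le_opNorm _ _).trans ?_
    rw [Pi.norm_single]; simpa using h
  rw [dbar, norm_mul]
  have := norm_add_le (fderiv ℝ f x (Pi.single j 1)) (I * fderiv ℝ f x (Pi.single j I))
  rw [norm_mul I, norm_I] at this
  norm_num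
  linarith

lemma norm_dee_le {f : (Fin n → ℂ) → ℂ} {x : Fin n → ℂ} {C : ℝ} (h : ‖fderiv ℝ f x‖ ≤ C)
    (j : Fin n) : ‖dee j f x‖ ≤ C := by
  have h1 : ‖fderiv ℝ f x (Pi.single j 1)‖ ≤ C := by
    refine (ContinuousLinearMap.le_opNorm _ _).trans ?_
    rw [Pi.norm_single]; simpa using h
  have h2 : ‖fderiv ℝ f x (Pi.single j I)‖ ≤ C := by
    refine (ContinuousLinearMap.le_opNorm _ _).trans ?_
    rw [Pi.norm_single]; simpa using h
  rw [dee, norm_mul]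
  have := norm_sub_le (fderiv ℝ f x (Pi.single j 1)) (I * fderiv ℝ f x (Pi.single j I))
  rw [norm_mul I, norm_I] at this
  norm_num
  linarith

lemma exists_cutoff (n : ℕ) {κ : ℝ} (hκ : 0 < κ) :
    ∃ η : (Fin n → ℂ) → ℂ, IsTest η ∧ (∀ x, ‖η x‖ ≤ 1) ∧ (∀ x, ‖x‖ ≤ 1 / κ → η x = 1) ∧
      ∀ x, ‖fderiv ℝ η x‖ ≤ κ := by
  let b : ContDiffBump (0 : Fin n → ℂ) := ⟨1, 2, one_pos, by norm_num⟩
  let β : (Fin n → ℂ) → ℂ := fun x => (b x : ℂ)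
  have hβ : IsTest β :=
    ⟨ofRealCLM.contDiff.comp b.contDiff, b.hasCompactSupport.comp_left (g := ofReal) ofReal_zero⟩
  obtain ⟨D, hD⟩ : ∃ D, ∀ x, ‖fderiv ℝ β x‖ ≤ D :=
    (hβ.2.fderiv ℝ).exists_bound_of_continuous (hβ.1.continuous_fderiv (by simp))
  have hD0 : 0 ≤ D := (norm_nonneg _).trans (hD 0)
  let t : ℝ := κ / (D + 1)
  have ht : 0 < t := by positivity
  have htκ : t ≤ κ := div_le_self hκ.le (by linarith)
  have hs : ContDiff ℝ ∞ fun x : Fin n → ℂ => t • x := contDiff_const_smul t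
  refine ⟨fun x => β (t • x), ⟨hβ.1.comp hs, hβ.2.comp_homeomorph (Homeomorph.smulOfNeZero t ht.ne')⟩,
    fun x => ?_, fun x hx => ?_, fun x => ?_⟩
  · simp only [β, norm_real, Real.norm_of_nonneg b.nonneg]
    exact b.le_one
  · have : b (t • x) = 1 := b.one_of_mem_closedBall <| by
      rw [mem_closedBall_zero_iff, norm_smul, Real.norm_of_nonneg ht.le]
      calc t * ‖x‖ ≤ κ * (1 / κ) := by gcongr
        _ = 1 := by field_simp
    simp [β, this]
  · have h1 := (hβ.1.diffAt (t • x)).hasFDerivAt.comp x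
      ((hasFDerivAt_id x).const_smul t)
    have h2 : HasFDerivAt (fun x => β (t • x)) _ x := h1
    rw [h2.fderiv]
    have : (fderiv ℝ β (t • x)).comp (t • ContinuousLinearMap.id ℝ (Fin n → ℂ)) =
        t • fderiv ℝ β (t • x) := by ext v; simp
    rw [this, norm_smul, Real.norm_of_nonneg ht.le]
    calc t * ‖fderiv ℝ β (t • x)‖ ≤ t * (D + 1) := by
          gcongr; linarith [hD (t • x)]
      _ = κ := by simp only [t]; field_simp

/-- The complex valued normalized bump function. -/
def bumpKernel (φ : ContDiffBump (0 : Fin n → ℂ)) (x : Fin n → ℂ) : ℂ := (φ.normed volume x : ℂ)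

lemma bumpKernel_isTest (φ : ContDiffBump (0 : Fin n → ℂ)) : IsTest (bumpKernel φ) :=
  ⟨ofRealCLM.contDiff.comp φ.contDiff_normed,
    φ.hasCompactSupport_normed.comp_left (g := ofReal) ofReal_zero⟩

lemma conj_bumpKernel (φ : ContDiffBump (0 : Fin n → ℂ)) (x : Fin n → ℂ) :
    conj (bumpKernel φ x) = bumpKernel φ x := conj_ofReal _

lemma lintegral_bumpKernel (φ : ContDiffBump (0 : Fin n → ℂ)) :
    ∫⁻ x, ‖bumpKernel φ x‖ₑ = 1 := by
  have h := ofReal_integral_eq_lintegral_ofReal (μ := volume) (f := φ.normed volume)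
    φ.integrable_normed (ae_of_all _ fun x => φ.nonneg_normed x)
  rw [φ.integral_normed, ENNReal.ofReal_one] at h
  rw [h]
  refine lintegral_congr fun x => ?_
  rw [bumpKernel, ← ofReal_norm, norm_real, Real.norm_of_nonneg (φ.nonneg_normed x)]

lemma norm_lt_of_bumpKernel_ne_zero {φ : ContDiffBump (0 : Fin n → ℂ)} {x : Fin n → ℂ}
    (h : bumpKernel φ x ≠ 0) : ‖x‖ < φ.rOut := by
  have : x ∈ Function.support (φ.normed volume) := fun h' => h (by simp [bumpKernel, h'])
  rwa [φ.support_normed_eq, mem_ball_zero_iff] at this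

lemma conv_bumpKernel (φ : ContDiffBump (0 : Fin n → ℂ)) (g : (Fin n → ℂ) → ℂ) :
    conv (bumpKernel φ) g =
      MeasureTheory.convolution (φ.normed volume) g (ContinuousLinearMap.lsmul ℝ ℝ) volume := by
  funext x
  rw [convolution_eq_swap]
  simp [conv, bumpKernel, mul_comm]

lemma aemeasurable_absConv {ρ g : (Fin n → ℂ) → ℂ} (hρ : Continuous ρ)
    (hg : AEStronglyMeasurable g volume) : AEMeasurable (absConv ρ g) := by
  have m1 : AEMeasurable (fun p : (Fin n → ℂ) × (Fin n → ℂ) => ‖g p.2‖ₑ)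
      (volume.prod volume) :=
    hg.enorm.comp_quasiMeasurePreserving Measure.quasiMeasurePreserving_snd
  have m2 : AEMeasurable (fun p : (Fin n → ℂ) × (Fin n → ℂ) => ‖ρ (p.1 - p.2)‖ₑ)
      (volume.prod volume) :=
    (hρ.comp (continuous_fst.sub continuous_snd)).enorm.aemeasurable
  exact (m1.mul m2).lintegral_prod_right'

lemma exists_modulus {f : (Fin n → ℂ) → ℂ} (hf : Continuous f) {S : Set (Fin n → ℂ)}
    (hS : IsCompact S) {κ : ℝ} (hκ : 0 < κ) :
    ∃ δ > 0, ∀ x ∈ S, ∀ y, ‖x - y‖ < δ → ‖f x - f y‖ ≤ κ := by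
  have h := hS.uniformContinuousAt_of_continuousAt f (fun x _ => hf.continuousAt)
    (Metric.dist_mem_uniformity hκ)
  obtain ⟨δ, hδ, h⟩ := Metric.mem_uniformity_dist.1 h
  refine ⟨δ, hδ, fun x hx y hxy => ?_⟩
  have := h (a := x) (b := y) (by rwa [dist_eq_norm]) hx
  rw [← dist_eq_norm]
  exact le_of_lt this

lemma ennreal_sq_add_le {κ : ℝ≥0} (h0 : 0 < κ) (h1 : κ ≤ 1) (a s : ℝ≥0∞) :
    (a + 2 * κ * s) ^ 2 ≤ (1 + κ) * a ^ 2 + 8 * κ * s ^ 2 := by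
  have hκ : (κ : ℝ≥0∞) ≠ 0 := by simpa using h0.ne'
  rcases eq_or_ne a ⊤ with rfl | ha
  · simp
  rcases eq_or_ne s ⊤ with rfl | hs
  · simp [ENNReal.mul_top, hκ]
  lift a to ℝ≥0 using ha
  lift s to ℝ≥0 using hs
  norm_cast
  rw [← NNReal.coe_le_coe]
  have h0' : (0 : ℝ) < κ := h0
  have h1' : (κ : ℝ) ≤ 1 := h1
  push_cast
  nlinarith [mul_nonneg h0'.le (sq_nonneg ((a : ℝ) - 2 * s)),
    mul_nonneg (mul_nonneg h0'.le (sub_nonneg.2 h1')) (sq_nonneg (s : ℝ))]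

end Regularity

section WeakForms

variable {n : ℕ} {W : WeightCoeff n} {ρ η : (Fin n → ℂ) → ℂ}

lemma ennreal_add_sq_le (a b : ℝ≥0∞) : (a + b) ^ 2 ≤ 2 * (a ^ 2 + b ^ 2) := by
  rcases eq_or_ne a ⊤ with rfl | ha
  · simp
  rcases eq_or_ne b ⊤ with rfl | hb
  · simp
  lift a to ℝ≥0 using ha
  lift b to ℝ≥0 using hb
  norm_cast
  rw [← NNReal.coe_le_coe]
  push_cast
  exact add_sq_le

lemma ennreal_sum_sq_le {ι : Type*} [Fintype ι] (f : ι → ℝ≥0∞) :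
    (∑ i, f i) ^ 2 ≤ Fintype.card ι * ∑ i, f i ^ 2 := by
  by_cases h : ∃ i, f i = ⊤
  · obtain ⟨i, hi⟩ := h
    have h1 : ∑ i, f i ^ 2 = ⊤ := ENNReal.sum_eq_top.2 ⟨i, Finset.mem_univ i, by simp [hi]⟩
    have h2 : (Fintype.card ι : ℝ≥0∞) ≠ 0 := by
      have : Nonempty ι := ⟨i⟩
      simp
    rw [h1, ENNReal.mul_top h2]
    exact le_top
  · push Not at h
    lift f to ι → ℝ≥0 using h
    beta_reduce
    norm_cast
    rw [← NNReal.coe_le_coe]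
    push_cast
    simpa using sq_sum_le_card_mul_sum_sq (s := Finset.univ) (f := fun i => (f i : ℝ))

lemma A_mul {G : (Fin n → ℂ) → ℂ} (hη : ContDiff ℝ ∞ η) (hG : ContDiff ℝ ∞ G) (k : Fin n)
    (x : Fin n → ℂ) :
    W.A k (fun y => η y * G y) x = η x * W.A k G x + dbar k η x * G x := by
  rw [WeightCoeff.A, dbar_mul hη hG, WeightCoeff.A]; ring

lemma B_mul {G : (Fin n → ℂ) → ℂ} (hη : ContDiff ℝ ∞ η) (hG : ContDiff ℝ ∞ G) (k : Fin n)
    (x : Fin n → ℂ) :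
    W.B k (fun y => η y * G y) x = η x * W.B k G x - dee k η x * G x := by
  rw [WeightCoeff.B, dee_mul hη hG, WeightCoeff.B]; ring

lemma enorm_cutoff_mul_convComm_le {a g : (Fin n → ℂ) → ℂ} {κ : ℝ≥0} (hη1 : ∀ x, ‖η x‖ ≤ 1)
    (ha : ∀ x y, η x ≠ 0 → ρ (x - y) ≠ 0 → ‖a x - a y‖ ≤ κ) (x : Fin n → ℂ) :
    ‖η x * convComm a ρ g x‖ₑ ≤ κ * absConv ρ g x := by
  by_cases h : η x = 0
  · simp [h]
  rw [enorm_mul]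
  have h1 : ‖η x‖ₑ ≤ 1 := by
    rw [← ofReal_norm]; exact ENNReal.ofReal_le_one.2 (hη1 x)
  have h2 := enorm_convComm_le (g := g) (c := κ) (a := a) (ρ := ρ) (x := x) ENNReal.coe_ne_top
    fun y hy => by
      rw [← ofReal_norm]; exact ENNReal.ofReal_le_of_le_toReal (by simpa using ha x y h hy)
  calc ‖η x‖ₑ * ‖convComm a ρ g x‖ₑ ≤ 1 * (κ * absConv ρ g x) := by gcongr
    _ = _ := one_mul _

lemma enorm_mul_conv_le {c : ℂ} {g : (Fin n → ℂ) → ℂ} {κ : ℝ≥0} (hc : ‖c‖ ≤ κ) (x : Fin n → ℂ) :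
    ‖c * conv ρ g x‖ₑ ≤ κ * absConv ρ g x := by
  rw [enorm_mul]
  have : ‖c‖ₑ ≤ κ := by
    rw [← ofReal_norm]; exact ENNReal.ofReal_le_of_le_toReal (by simpa using hc)
  gcongr
  exact enorm_conv_le x

/-- The weak form of `A_k g_j = A_j g_k`. -/
def WeakClosed (W : WeightCoeff n) (g : Fin n → (Fin n → ℂ) → ℂ) : Prop :=
  ∀ ψ, IsTest ψ → ∀ i j, ∫ x, conj (W.B i ψ x) * g j x = ∫ x, conj (W.B j ψ x) * g i x

/-- The weak form of `∑ j, B_j g_j = k`. -/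
def WeakDiv (W : WeightCoeff n) (g : Fin n → (Fin n → ℂ) → ℂ) (k : (Fin n → ℂ) → ℂ) : Prop :=
  ∀ ψ, IsTest ψ → ∑ j, ∫ x, conj (W.A j ψ x) * g j x = ∫ x, conj (ψ x) * k x

variable {g : Fin n → (Fin n → ℂ) → ℂ} {k : (Fin n → ℂ) → ℂ} {κ : ℝ≥0}

lemma enorm_curl_le (hρ : IsTest ρ) (hr : ∀ x, conj (ρ x) = ρ x) (hη : IsTest η)
    (hη1 : ∀ x, ‖η x‖ ≤ 1) (hη' : ∀ x, ‖fderiv ℝ η x‖ ≤ κ)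
    (ha : ∀ k x y, η x ≠ 0 → ρ (x - y) ≠ 0 → ‖W.a k x - W.a k y‖ ≤ κ)
    (hg : ∀ j, LocallyIntegrable (g j)) (h1 : WeakClosed W g) (i j : Fin n) (x : Fin n → ℂ) :
    ‖W.A i (fun y => η y * conv ρ (g j) y) x - W.A j (fun y => η y * conv ρ (g i) y) x‖ₑ ≤
      2 * κ * (absConv ρ (g i) x + absConv ρ (g j) x) := by
  rw [A_mul hη.1 (conv_contDiff hρ (hg j)), A_mul hη.1 (conv_contDiff hρ (hg i)),
    A_conv hρ hr (hg j), A_conv hρ hr (hg i), h1 _ (translate_isTest hρ x) i j]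
  set c := ∫ y, conj (W.B j (fun y => ρ (x - y)) y) * g i y
  have e : ∀ p q r s : ℂ, η x * (c + p) + r - (η x * (c + q) + s) =
    (η x * p + r) - (η x * q + s) := fun p q r s => by ring
  rw [e]
  calc _ ≤ _ := (enorm_sub_le).trans (add_le_add (enorm_add_le _ _) (enorm_add_le _ _))
    _ ≤ (κ * absConv ρ (g j) x + κ * absConv ρ (g j) x) +
        (κ * absConv ρ (g i) x + κ * absConv ρ (g i) x) := by
      gcongr
      · exact enorm_cutoff_mul_convComm_le hη1 (ha i) x
      · exact enorm_mul_conv_le (norm_dbar_le (hη' x) i) x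
      · exact enorm_cutoff_mul_convComm_le hη1 (ha j) x
      · exact enorm_mul_conv_le (norm_dbar_le (hη' x) j) x
    _ = _ := by ring

lemma enorm_divergence_le (hρ : IsTest ρ) (hr : ∀ x, conj (ρ x) = ρ x) (hη : IsTest η)
    (hη1 : ∀ x, ‖η x‖ ≤ 1) (hη' : ∀ x, ‖fderiv ℝ η x‖ ≤ κ)
    (ha : ∀ k x y, η x ≠ 0 → ρ (x - y) ≠ 0 → ‖W.a k x - W.a k y‖ ≤ κ)
    (hg : ∀ j, LocallyIntegrable (g j)) (h2 : WeakDiv W g k) (x : Fin n → ℂ) :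
    ‖∑ j, W.B j (fun y => η y * conv ρ (g j) y) x‖ₑ ≤
      absConv ρ k x + 2 * κ * ∑ j, absConv ρ (g j) x := by
  have e : ∀ j, W.B j (fun y => η y * conv ρ (g j) y) x =
      η x * (∫ y, conj (W.A j (fun y => ρ (x - y)) y) * g j y) +
      (η x * convComm (fun y => conj (W.a j y)) ρ (g j) x - dee j η x * conv ρ (g j) x) :=
    fun j => by
      rw [B_mul hη.1 (conv_contDiff hρ (hg j)), B_conv hρ hr (hg j)]; ring
  have e2 : ∫ y, conj (ρ (x - y)) * k y = conv ρ k x := by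
    simp only [hr, conv, mul_comm]
  simp only [e, Finset.sum_add_distrib, ← Finset.mul_sum]
  rw [h2 _ (translate_isTest hρ x), e2]
  refine (enorm_add_le _ _).trans (add_le_add ?_ ?_)
  · rw [enorm_mul]
    have h1 : ‖η x‖ₑ ≤ 1 := by
      rw [← ofReal_norm]; exact ENNReal.ofReal_le_one.2 (hη1 x)
    calc ‖η x‖ₑ * ‖conv ρ k x‖ₑ ≤ 1 * absConv ρ k x := by gcongr; exact enorm_conv_le x
      _ = _ := one_mul _
  · rw [Finset.mul_sum]
    refine (enorm_sum_le _ _).trans (Finset.sum_le_sum fun j _ => ?_)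
    refine enorm_sub_le.trans ?_
    calc _ ≤ κ * absConv ρ (g j) x + κ * absConv ρ (g j) x := by
          gcongr
          · refine enorm_cutoff_mul_convComm_le hη1 (fun x y h h' => ?_) x
            rw [← map_sub, norm_conj]; exact ha j x y h h'
          · exact enorm_mul_conv_le (norm_dee_le (hη' x) j) x
      _ = _ := by ring

/-- The basic estimate for mollified and truncated weak forms. -/
lemma sum_sqNorm_mollified_le (hρ : IsTest ρ) (hr : ∀ x, conj (ρ x) = ρ x)
    (hρ1 : ∫⁻ x, ‖ρ x‖ₑ = 1) (hη : IsTest η)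
    (hη1 : ∀ x, ‖η x‖ ≤ 1) (hη' : ∀ x, ‖fderiv ℝ η x‖ ≤ κ) (hκ0 : 0 < κ) (hκ1 : κ ≤ 1)
    (ha : ∀ k x y, η x ≠ 0 → ρ (x - y) ≠ 0 → ‖W.a k x - W.a k y‖ ≤ κ)
    (hg : ∀ j, MemLp (g j) 2) (hk : MemLp k 2) (h1 : WeakClosed W g) (h2 : WeakDiv W g k) :
    ∑ j, sqNorm (fun x => η x * conv ρ (g j) x) ≤
      sqNorm k + κ * (sqNorm k + 24 * n * ∑ j, sqNorm (g j)) := by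
  have hgl : ∀ j, LocallyIntegrable (g j) := fun j => (hg j).locallyIntegrable (by norm_num)
  have hT : ∀ j, IsTest (fun x => η x * conv ρ (g j) x) := fun j =>
    ⟨hη.1.mul (conv_contDiff hρ (hgl j)), hη.2.mul_right⟩
  have hm : ∀ j, AEMeasurable (absConv ρ (g j)) := fun j =>
    aemeasurable_absConv hρ.1.continuous (hg j).1
  have hY : ∀ j, ∫⁻ x, absConv ρ (g j) x ^ 2 ≤ sqNorm (g j) := fun j =>
    lintegral_absConv_sq_le hρ.1.continuous hρ1 (hg j).1
  have hYs : ∫⁻ x, ∑ j, absConv ρ (g j) x ^ 2 ≤ ∑ j, sqNorm (g j) := by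
    rw [lintegral_finsetSum' _ fun j _ => (hm j).pow_const 2]
    exact Finset.sum_le_sum fun j _ => hY j
  have hD : sqNorm (fun x => ∑ j, W.B j (fun y => η y * conv ρ (g j) y) x) ≤
      (1 + κ) * sqNorm k + 8 * κ * n * ∑ j, sqNorm (g j) := by
    calc _ ≤ ∫⁻ x, ((1 + κ) * absConv ρ k x ^ 2 +
          8 * κ * n * ∑ j, absConv ρ (g j) x ^ 2) := by
          refine lintegral_mono fun x => ?_
          calc _ ≤ _ := pow_le_pow_left' (enorm_divergence_le hρ hr hη hη1 hη' ha hgl h2 x) 2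
            _ ≤ _ := ennreal_sq_add_le hκ0 hκ1 _ _
            _ ≤ (1 + κ) * absConv ρ k x ^ 2 +
              8 * κ * (n * ∑ j, absConv ρ (g j) x ^ 2) := by
                gcongr
                simpa using ennreal_sum_sq_le fun j => absConv ρ (g j) x
            _ = _ := by ring
      _ ≤ _ := by
          rw [lintegral_add_left' (((aemeasurable_absConv hρ.1.continuous hk.1).pow_const 2
            ).const_mul _), lintegral_const_mul' _ _ (by simp),
            lintegral_const_mul' _ _ (by finiteness)]
          gcongr
          exact lintegral_absConv_sq_le hρ.1.continuous hρ1 hk.1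
  have hC : ∀ i j, sqNorm (fun x => W.A j (fun y => η y * conv ρ (g i) y) x -
      W.A i (fun y => η y * conv ρ (g j) y) x) ≤ 8 * κ * (sqNorm (g i) + sqNorm (g j)) := by
    intro i j
    calc _ ≤ ∫⁻ x, 8 * κ * (absConv ρ (g i) x ^ 2 + absConv ρ (g j) x ^ 2) := by
          refine lintegral_mono fun x => ?_
          calc _ ≤ _ := pow_le_pow_left'
                  (enorm_curl_le hρ hr hη hη1 hη' ha hgl h1 j i x) 2
            _ = 4 * κ * κ * (absConv ρ (g i) x + absConv ρ (g j) x) ^ 2 := by ring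
            _ ≤ 4 * κ * 1 * (2 * (absConv ρ (g i) x ^ 2 + absConv ρ (g j) x ^ 2)) := by
                gcongr
                · exact_mod_cast hκ1
                · exact ennreal_add_sq_le _ _
            _ = _ := by ring
      _ ≤ _ := by
          rw [lintegral_const_mul' _ _ (by finiteness), lintegral_add_left' ((hm i).pow_const 2)]
          gcongr <;> exact hY _
  refine (basic_estimate_sqNorm W hT).trans ?_
  refine (add_le_add hD (Finset.sum_le_sum fun i _ => Finset.sum_le_sum fun j _ => hC i j)).trans ?_
  simp only [← Finset.mul_sum, Finset.sum_add_distrib, Finset.sum_const, Finset.card_univ,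
    Fintype.card_fin, nsmul_eq_mul]
  apply le_of_eq
  ring

end WeakForms

section Limit

variable {n : ℕ} {W : WeightCoeff n} {g : Fin n → (Fin n → ℂ) → ℂ} {k : (Fin n → ℂ) → ℂ}

lemma exists_mollified_bound (hg : ∀ j, MemLp (g j) 2) (hk : MemLp k 2)
    (h1 : WeakClosed W g) (h2 : WeakDiv W g k) {κ : ℝ≥0} (hκ0 : 0 < κ) (hκ1 : κ ≤ 1) :
    ∃ (η : (Fin n → ℂ) → ℂ) (φ : ContDiffBump (0 : Fin n → ℂ)),
      IsTest η ∧ (∀ x, ‖x‖ ≤ 1 / κ → η x = 1) ∧ φ.rOut ≤ κ ∧ φ.rOut = 2 * φ.rIn ∧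
      ∑ j, sqNorm (fun x => η x * conv (bumpKernel φ) (g j) x) ≤
        sqNorm k + κ * (sqNorm k + 24 * n * ∑ j, sqNorm (g j)) := by
  have hκ0' : (0 : ℝ) < κ := hκ0
  obtain ⟨η, hη, hη1, hηκ, hη'⟩ := exists_cutoff n hκ0'
  choose δ hδ hδ' using fun j => exists_modulus (W.smooth j).continuous hη.2 hκ0'
  obtain ⟨r, hr0, hrκ, hr⟩ : ∃ r > 0, r ≤ (κ : ℝ) ∧ ∀ j, r ≤ δ j := by
    obtain ⟨r, hr0, hr⟩ : ∃ r > 0, ∀ j, r ≤ δ j := by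
      have : ∀ᶠ r in 𝓝[>] (0 : ℝ), ∀ j, r ≤ δ j := by
        rw [eventually_all]
        intro j
        filter_upwards [nhdsWithin_le_nhds (Iic_mem_nhds (hδ j))] with r hr using hr
      obtain ⟨r, hr, hr0⟩ := (this.and self_mem_nhdsWithin).exists
      exact ⟨r, hr0, hr⟩
    exact ⟨min r κ, lt_min hr0 hκ0', min_le_right _ _, fun j => (min_le_left _ _).trans (hr j)⟩
  let φ : ContDiffBump (0 : Fin n → ℂ) := ⟨r / 2, r, by positivity, by linarith⟩
  refine ⟨η, φ, hη, hηκ, hrκ, by simp only [φ]; ring, ?_⟩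
  refine sum_sqNorm_mollified_le (bumpKernel_isTest φ) (conj_bumpKernel φ) (lintegral_bumpKernel φ)
    hη hη1 hη' hκ0 hκ1 (fun j x y hx hxy => ?_) hg hk h1 h2
  refine hδ' j x (subset_tsupport _ hx) y ?_
  exact (norm_lt_of_bumpKernel_ne_zero hxy).trans_le (hr j)

/-- The basic estimate for weak `L²` forms. -/
theorem sum_sqNorm_le_of_weak (hg : ∀ j, MemLp (g j) 2) (hk : MemLp k 2)
    (h1 : WeakClosed W g) (h2 : WeakDiv W g k) : ∑ j, sqNorm (g j) ≤ sqNorm k := by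
  let κ : ℕ → ℝ≥0 := fun i => 1 / (i + 1)
  have hκ0 : ∀ i, 0 < κ i := fun i => by positivity
  have hκ1 : ∀ i, κ i ≤ 1 := fun i => by
    simp only [κ]; rw [div_le_one (by positivity)]; simp
  have hκt : Tendsto κ atTop (𝓝 0) := by
    rw [← NNReal.tendsto_coe]
    simpa [κ] using tendsto_one_div_add_atTop_nhds_zero_nat (𝕜 := ℝ)
  have hκt' : Tendsto (fun i => (κ i : ℝ)) atTop (𝓝 0) := by
    simpa using (NNReal.tendsto_coe.2 hκt)
  choose η φ hη hη1 hφκ hφ hb using fun i => exists_mollified_bound hg hk h1 h2 (hκ0 i) (hκ1 i)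
  have hgl : ∀ j, LocallyIntegrable (g j) := fun j => (hg j).locallyIntegrable (by norm_num)
  have hfin : ∀ f : (Fin n → ℂ) → ℂ, MemLp f 2 → sqNorm f ≠ ⊤ := fun f hf => by
    have := (eLpNorm_lt_top_iff_lintegral_rpow_enorm_lt_top two_ne_zero ENNReal.ofNat_ne_top).1 hf.2
    simpa [sqNorm] using this.ne
  have hrt : Tendsto (fun i => (φ i).rOut) atTop (𝓝 0) :=
    squeeze_zero (fun i => (φ i).rOut_pos.le) hφκ hκt'
  have hlim : ∀ᵐ x, Tendsto (fun i => ∑ j, ‖η i x * conv (bumpKernel (φ i)) (g j) x‖ₑ ^ 2) atTop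
      (𝓝 (∑ j, ‖g j x‖ₑ ^ 2)) := by
    have hae : ∀ j, ∀ᵐ x, Tendsto (fun i => conv (bumpKernel (φ i)) (g j) x) atTop
        (𝓝 (g j x)) := fun j => by
      simp only [conv_bumpKernel]
      exact ContDiffBump.ae_convolution_tendsto_right_of_locallyIntegrable (K := 2) hrt
        (Eventually.of_forall fun i => (hφ i).le) (hgl j)
    filter_upwards [ae_all_iff.2 hae] with x hx
    refine tendsto_finsetSum _ fun j _ => ?_
    have hev : ∀ᶠ i in atTop, η i x = 1 := by
      have : ∀ᶠ i in atTop, (κ i : ℝ) < 1 / (‖x‖ + 1) :=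
        hκt'.eventually_lt_const (by positivity)
      filter_upwards [this] with i hi
      refine hη1 i x ?_
      rw [lt_div_iff₀ (by positivity)] at hi
      have h0 : (0 : ℝ) < κ i := hκ0 i
      rw [le_div_iff₀ h0]
      nlinarith
    refine (ENNReal.Tendsto.pow (n := 2) (hx j).enorm).congr' ?_
    filter_upwards [hev] with i hi
    rw [hi, one_mul]
  have hmj : ∀ i j, AEMeasurable
      (fun x => ‖η i x * conv (bumpKernel (φ i)) (g j) x‖ₑ ^ 2) volume := fun i j =>
    (((hη i).1.continuous.mul
      (conv_contDiff (bumpKernel_isTest _) (hgl j)).continuous).enorm.aemeasurable).pow_const 2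
  have hm : ∀ i, AEMeasurable
      (fun x => ∑ j, ‖η i x * conv (bumpKernel (φ i)) (g j) x‖ₑ ^ 2) volume := fun i =>
    Finset.aemeasurable_fun_sum _ fun j _ => hmj i j
  calc ∑ j, sqNorm (g j) = ∫⁻ x, ∑ j, ‖g j x‖ₑ ^ 2 := by
        rw [lintegral_finsetSum' _ fun j _ => (hg j).1.enorm.pow_const 2]; rfl
    _ = ∫⁻ x, liminf (fun i => ∑ j, ‖η i x * conv (bumpKernel (φ i)) (g j) x‖ₑ ^ 2) atTop := by
        refine lintegral_congr_ae ?_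
        filter_upwards [hlim] with x hx using hx.liminf_eq.symm
    _ ≤ liminf (fun i => ∫⁻ x, ∑ j, ‖η i x * conv (bumpKernel (φ i)) (g j) x‖ₑ ^ 2) atTop :=
        lintegral_liminf_le' hm
    _ ≤ liminf (fun i => sqNorm k + κ i * (sqNorm k + 24 * n * ∑ j, sqNorm (g j))) atTop := by
        refine liminf_le_liminf (Eventually.of_forall fun i => ?_)
        refine le_trans (le_of_eq ?_) (hb i)
        rw [lintegral_finsetSum' _ fun j _ => hmj i j]
        rfl
    _ = sqNorm k := by
        refine Tendsto.liminf_eq ?_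
        have h0 : Tendsto (fun i => (κ i : ℝ≥0∞)) atTop (𝓝 0) := by
          rw [← ENNReal.coe_zero]; exact ENNReal.tendsto_coe.2 hκt
        have hC : sqNorm k + 24 * n * ∑ j, sqNorm (g j) ≠ ⊤ := by
          have h1 := hfin k hk
          have h2 : ∑ j, sqNorm (g j) ≠ ⊤ := ENNReal.sum_ne_top.2 fun j _ => hfin _ (hg j)
          finiteness
        have := (ENNReal.Tendsto.mul_const h0 (Or.inr hC)).const_add (sqNorm k)
        simpa using this

end Limit

section Existence

variable {n : ℕ} {W : WeightCoeff n} {f g u : (Fin n → ℂ) → ℂ}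

/-- The Hilbert space of square integrable functions on `ℂⁿ`. -/
abbrev L2C (n : ℕ) := Lp ℂ 2 (volume : Measure (Fin n → ℂ))

/-- The Hilbert space of square integrable `(0,1)`-forms on `ℂⁿ`. -/
abbrev L2Form (n : ℕ) := PiLp 2 fun _ : Fin n => L2C n

lemma inner_eq_integral {F G : L2C n} (hF : F =ᵐ[volume] f) (hG : G =ᵐ[volume] g) :
    inner ℂ F G = ∫ x, conj (f x) * g x := by
  rw [L2.inner_def]
  refine integral_congr_ae ?_
  filter_upwards [hF, hG] with x h1 h2
  rw [h1, h2, RCLike.inner_apply, mul_comm]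

lemma sqNorm_eq_norm_sq {F : L2C n} (hF : F =ᵐ[volume] f) :
    sqNorm f = ENNReal.ofReal (‖F‖ ^ 2) := by
  have h1 : sqNorm f = sqNorm F := lintegral_congr_ae <| by
    filter_upwards [hF] with x hx; rw [hx]
  have h2 := eLpNorm_nnreal_pow_eq_lintegral (f := F) (μ := volume) (p := 2) two_ne_zero
  rw [h1, ENNReal.ofReal_pow (norm_nonneg _), ofReal_norm, Lp.enorm_def]
  simpa [sqNorm] using h2.symm

lemma IsTest.exists_toLp (hf : IsTest f) : ∃ F : L2C n, F =ᵐ[volume] f :=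
  ⟨hf.memLp.toLp f, hf.memLp.coeFn_toLp⟩

lemma B_add (hf : IsTest f) (hg : IsTest g) (j : Fin n) (x : Fin n → ℂ) :
    W.B j (fun y => f y + g y) x = W.B j f x + W.B j g x := by
  simp only [WeightCoeff.B, dee_add hf.1 hg.1]; ring

lemma B_const_mul (hf : IsTest f) (c : ℂ) (j : Fin n) (x : Fin n → ℂ) :
    W.B j (fun y => c * f y) x = c * W.B j f x := by
  simp only [WeightCoeff.B, dee_mul contDiff_const hf.1, dee_const]; ring

/-- The space of divergences of test forms. -/
def divRange (W : WeightCoeff n) : Submodule ℂ (L2C n) where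
  carrier := {F | ∃ g : Fin n → (Fin n → ℂ) → ℂ, (∀ j, IsTest (g j)) ∧
    F =ᵐ[volume] fun x => ∑ j, W.B j (g j) x}
  zero_mem' := by
    refine ⟨fun _ _ => 0, fun j => IsTest.zero, ?_⟩
    filter_upwards [Lp.coeFn_zero ℂ 2 (volume : Measure (Fin n → ℂ))] with x hx
    rw [hx]
    simp [WeightCoeff.B, dee_const]
  add_mem' := by
    rintro F G ⟨f, hf, hF⟩ ⟨g, hg, hG⟩
    refine ⟨fun j x => f j x + g j x, fun j => (hf j).add (hg j), ?_⟩
    filter_upwards [Lp.coeFn_add F G, hF, hG] with x h h1 h2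
    rw [h, Pi.add_apply, h1, h2, ← Finset.sum_add_distrib]
    simp only [B_add (hf _) (hg _)]
  smul_mem' := by
    rintro c F ⟨f, hf, hF⟩
    refine ⟨fun j x => c * f j x, fun j => (hf j).smooth_mul contDiff_const, ?_⟩
    filter_upwards [Lp.coeFn_smul c F, hF] with x h h1
    rw [h, Pi.smul_apply, h1, smul_eq_mul, Finset.mul_sum]
    simp only [B_const_mul (hf _)]

/-- The closure of the space of gradients of test functions. -/
def gradClosure (W : WeightCoeff n) : Submodule ℂ (L2Form n) :=
  (Submodule.span ℂ {G : L2Form n | ∃ w, IsTest w ∧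
    ∀ j, G j =ᵐ[volume] W.A j w}).topologicalClosure

lemma gradClosure_weakClosed {G : L2Form n} (hG : G ∈ gradClosure W) :
    WeakClosed W fun j => G j := by
  intro ψ hψ i j
  obtain ⟨P, hP⟩ := (hψ.B (W := W) i).exists_toLp
  obtain ⟨Q, hQ⟩ := (hψ.B (W := W) j).exists_toLp
  let L : L2Form n →L[ℂ] ℂ :=
    ((innerSL ℂ P).comp (PiLp.proj 2 (𝕜 := ℂ) (fun _ : Fin n => L2C n) j) -
      (innerSL ℂ Q).comp (PiLp.proj 2 (𝕜 := ℂ) (fun _ : Fin n => L2C n) i))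
  let S : Submodule ℂ (L2Form n) := L.toLinearMap.ker
  have hS : ∀ H : L2Form n, H ∈ S ↔ inner ℂ P (H j) = inner ℂ Q (H i) := fun H => by
    simp [S, L, sub_eq_zero]
  have hSc : IsClosed (S : Set (L2Form n)) := L.isClosed_ker
  have hle : gradClosure W ≤ S := by
    refine Submodule.topologicalClosure_minimal _ (Submodule.span_le.2 ?_) hSc
    rintro H ⟨w, hw, hH⟩
    refine (hS H).2 ?_
    rw [inner_eq_integral hP (hH j), inner_eq_integral hQ (hH i),
      integral_conj_B_mul hψ (hw.A j), integral_conj_B_mul hψ (hw.A i)]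
    simp only [A_A_comm hw]
  have := (hS G).1 (hle hG)
  rwa [inner_eq_integral hP (ae_eq_refl _), inner_eq_integral hQ (ae_eq_refl _)] at this

/-- The a priori inequality dual to the solution of the Cauchy-Riemann equations. -/
lemma norm_inner_divRange_le (hu : IsTest u) {U F : L2C n} {V : L2Form n}
    (hU : U =ᵐ[volume] u) (hV : ∀ j, V j =ᵐ[volume] W.A j u) (hF : F ∈ divRange W) :
    ‖inner ℂ F U‖ ≤ ‖F‖ * ‖V‖ := by
  obtain ⟨g, hg, hFg⟩ := hF
  choose γ hγ using fun j => (hg j).exists_toLp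
  let Γ : L2Form n := WithLp.toLp 2 γ
  have hΓ : ∀ j, Γ j =ᵐ[volume] g j := hγ
  have hN : CompleteSpace (gradClosure W) :=
    (Submodule.isClosed_topologicalClosure _).completeSpace_coe
  let Γ' : L2Form n := (gradClosure W).starProjection Γ
  have hΓ' : Γ' ∈ gradClosure W := Submodule.starProjection_apply_mem _ _
  have hgrad : ∀ (w : (Fin n → ℂ) → ℂ) (hw : IsTest w) (H : L2Form n)
      (hH : ∀ j, H j =ᵐ[volume] W.A j w), inner ℂ H Γ' = inner ℂ H Γ := by
    intro w hw H hH
    have hmem : H ∈ gradClosure W :=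
      Submodule.le_topologicalClosure _ (Submodule.subset_span ⟨w, hw, hH⟩)
    have := Submodule.starProjection_inner_eq_zero (K := gradClosure W) Γ H hmem
    rw [inner_sub_left, sub_eq_zero] at this
    have h2 := congrArg conj this
    rw [inner_conj_symm, inner_conj_symm] at h2
    exact h2.symm
  have hadj : ∀ (w : (Fin n → ℂ) → ℂ) (hw : IsTest w),
      ∑ j, ∫ x, conj (W.A j w x) * g j x = ∫ x, conj (w x) * ∑ j, W.B j (g j) x := by
    intro w hw
    simp only [integral_conj_A_mul hw (hg _), Finset.mul_sum]
    rw [integral_finsetSum]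
    intro j _
    exact (((hg j).B j).smooth_mul (contDiff_conj hw.1)).integrable
  have hdiv : WeakDiv W (fun j => Γ' j) F := by
    intro ψ hψ
    choose P hP using fun j => (hψ.A (W := W) j).exists_toLp
    have h := hgrad ψ hψ (WithLp.toLp 2 P) hP
    rw [PiLp.inner_apply, PiLp.inner_apply] at h
    calc _ = ∑ j, inner ℂ (P j) (Γ' j) := by
          refine Finset.sum_congr rfl fun j _ => ?_
          rw [inner_eq_integral (hP j) (ae_eq_refl _)]
      _ = ∑ j, inner ℂ (P j) (Γ j) := h
      _ = ∑ j, ∫ x, conj (W.A j ψ x) * g j x :=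
          Finset.sum_congr rfl fun j _ => inner_eq_integral (hP j) (hΓ j)
      _ = _ := by
          rw [hadj ψ hψ]
          refine integral_congr_ae ?_
          filter_upwards [hFg] with x hx
          rw [hx]
  have hle : ‖Γ'‖ ≤ ‖F‖ := by
    have h := sum_sqNorm_le_of_weak (fun j => Lp.memLp (Γ' j)) (Lp.memLp F)
      (gradClosure_weakClosed hΓ') hdiv
    simp only [sqNorm_eq_norm_sq (ae_eq_refl _)] at h
    rw [← ENNReal.ofReal_sum_of_nonneg fun j _ => by positivity, ← PiLp.norm_sq_eq_of_L2] at h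
    rw [ENNReal.ofReal_le_ofReal_iff (by positivity)] at h
    exact le_of_sq_le_sq h (norm_nonneg _)
  have hFU : inner ℂ U F = inner ℂ V Γ' := by
    rw [hgrad u hu V hV, inner_eq_integral hU hFg, ← hadj u hu, PiLp.inner_apply]
    exact Finset.sum_congr rfl fun j _ => (inner_eq_integral (hV j) (hΓ j)).symm
  rw [← inner_conj_symm, norm_conj, hFU]
  calc _ ≤ ‖V‖ * ‖Γ'‖ := norm_inner_le_norm _ _
    _ ≤ ‖F‖ * ‖V‖ := by rw [mul_comm]; gcongr

/-- The `L²` existence theorem for the twisted Cauchy-Riemann equations, for data `A u`. -/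
theorem exists_twisted_solution (W : WeightCoeff n) (hu : IsTest u) :
    ∃ v : (Fin n → ℂ) → ℂ, MemLp v 2 ∧
      (∀ ψ, IsTest ψ → ∀ j, ∫ x, conj (W.B j ψ x) * (u x - v x) = 0) ∧
      sqNorm v ≤ ∑ j, sqNorm (W.A j u) := by
  obtain ⟨U, hU⟩ := hu.exists_toLp
  choose ν hν using fun j => (hu.A (W := W) j).exists_toLp
  let V : L2Form n := WithLp.toLp 2 ν
  let R : Submodule ℂ (L2C n) := (divRange W).topologicalClosure
  have hR : CompleteSpace R := (Submodule.isClosed_topologicalClosure _).completeSpace_coe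
  have hbound : ∀ F ∈ R, ‖inner ℂ F U‖ ≤ ‖F‖ * ‖V‖ := by
    intro F hF
    have hcl : IsClosed {F : L2C n | ‖inner ℂ F U‖ ≤ ‖F‖ * ‖V‖} :=
      isClosed_le (by fun_prop) (by fun_prop)
    exact closure_minimal (fun F hF => norm_inner_divRange_le hu hU hν hF) hcl hF
  let v : L2C n := R.starProjection U
  have hvR : v ∈ R := Submodule.starProjection_apply_mem _ _
  have hperp : ∀ F ∈ R, inner ℂ F (U - v) = 0 := fun F hF =>
    (Submodule.sub_starProjection_mem_orthogonal U) F hF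
  refine ⟨v, Lp.memLp v, fun ψ hψ j => ?_, ?_⟩
  · obtain ⟨F, hF⟩ := (hψ.B (W := W) j).exists_toLp
    have hmem : F ∈ R := by
      refine Submodule.le_topologicalClosure _ ⟨Function.update (fun _ _ => 0) j ψ, fun i => ?_, ?_⟩
      · rcases eq_or_ne i j with rfl | h
        · simpa using hψ
        · simpa [h] using IsTest.zero
      · filter_upwards [hF] with x hx
        rw [hx, Finset.sum_eq_single j]
        · simp
        · intro i _ h
          simp [h, WeightCoeff.B, dee_const]
        · simp
    have huv : (U - v : L2C n) =ᵐ[volume] fun x => u x - v x := by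
      filter_upwards [Lp.coeFn_sub U v, hU] with x h1 h2
      rw [h1, Pi.sub_apply, h2]
    rw [← inner_eq_integral hF huv]
    exact hperp F hmem
  · have h1 : ‖v‖ ^ 2 ≤ ‖v‖ * ‖V‖ := by
      have h := hperp v hvR
      rw [inner_sub_right, sub_eq_zero, inner_self_eq_norm_sq_to_K] at h
      have h2 := hbound v hvR
      rw [h] at h2
      simpa using h2
    have h2 : ‖v‖ ≤ ‖V‖ := by
      by_contra hlt
      push Not at hlt
      nlinarith [norm_nonneg V]
    rw [sqNorm_eq_norm_sq (ae_eq_refl _)]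
    calc ENNReal.ofReal (‖v‖ ^ 2) ≤ ENNReal.ofReal (‖V‖ ^ 2) := by gcongr
      _ = _ := by
        rw [PiLp.norm_sq_eq_of_L2, ENNReal.ofReal_sum_of_nonneg fun j _ => by positivity]
        exact Finset.sum_congr rfl fun j _ => (sqNorm_eq_norm_sq (hν j)).symm

end Existence

section Weight

variable {n : ℕ} {ι : Type*} [Fintype ι] {f : (Fin n → ℂ) → ℂ}

/-- Smooth functions annihilated by all `∂/∂z̄_j`. -/
def IsHolo (f : (Fin n → ℂ) → ℂ) : Prop := ContDiff ℝ ∞ f ∧ ∀ j x, dbar j f x = 0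

lemma dee_dee_comm (hf : ContDiff ℝ ∞ f) (j k : Fin n) (x : Fin n → ℂ) :
    dee j (dee k f) x = dee k (dee j f) x := by
  have h := dbar_dbar_comm (x := x) (contDiff_conj hf) j k
  have e : ∀ k, dbar k (fun y => conj (f y)) = fun y => conj (dee k f y) := fun k =>
    funext fun y => dbar_conj hf k
  rw [e, e, dbar_conj (dee_contDiff hf k), dbar_conj (dee_contDiff hf j)] at h
  exact (starRingEnd ℂ).injective h

lemma dbar_cexp (hf : ContDiff ℝ ∞ f) (j : Fin n) (x : Fin n → ℂ) :
    dbar j (fun y => cexp (f y)) x = cexp (f x) * dbar j f x := by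
  have h : HasFDerivAt (fun y => cexp (f y)) (cexp (f x) • fderiv ℝ f x) x :=
    (hf.diffAt x).hasFDerivAt.cexp
  simp only [dbar, h.fderiv, smul_apply, smul_eq_mul]
  ring

lemma dbar_dee_eq_zero (hf : IsHolo f) (j k : Fin n) (x : Fin n → ℂ) :
    dbar j (dee k f) x = 0 := by
  rw [dbar_dee_comm hf.1, show dbar j f = fun _ => 0 from funext fun y => hf.2 j y, dee_const]

lemma dbar_mul_conj {p q : (Fin n → ℂ) → ℂ} (hp : IsHolo p) (hq : ContDiff ℝ ∞ q) (j : Fin n)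
    (x : Fin n → ℂ) : dbar j (fun y => p y * conj (q y)) x = p x * conj (dee j q x) := by
  rw [dbar_mul hp.1 (contDiff_conj hq), hp.2, dbar_conj hq]; ring

lemma dbar_half_sum {F : ι → (Fin n → ℂ) → ℂ} (hF : ∀ i, ContDiff ℝ ∞ (F i)) (j : Fin n)
    (x : Fin n → ℂ) :
    dbar j (fun y => (1 / 2 : ℂ) * ∑ i, F i y) x = (1 / 2 : ℂ) * ∑ i, dbar j (F i) x := by
  rw [dbar_mul contDiff_const (ContDiff.sum fun i _ => hF i), dbar_const, zero_mul, zero_add,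
    dbar_sum _ fun i _ => hF i]

lemma dee_half_sum {F : ι → (Fin n → ℂ) → ℂ} (hF : ∀ i, ContDiff ℝ ∞ (F i)) (j : Fin n)
    (x : Fin n → ℂ) :
    dee j (fun y => (1 / 2 : ℂ) * ∑ i, F i y) x = (1 / 2 : ℂ) * ∑ i, dee j (F i) x := by
  rw [dee_mul contDiff_const (ContDiff.sum fun i _ => hF i), dee_const, zero_mul, zero_add,
    dee_sum _ fun i _ => hF i]

variable {q : ι → (Fin n → ℂ) → ℂ}

/-- The coefficients of the weight `∑ i, |q i|²` for holomorphic `q`. -/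
def holoWeight (q : ι → (Fin n → ℂ) → ℂ) (hq : ∀ i, IsHolo (q i))
    (hpos : ∀ x (c : Fin n → ℂ), ∑ j, ‖c j‖ ^ 2 ≤ ∑ i, ‖∑ j, dee j (q i) x * c j‖ ^ 2) :
    WeightCoeff n where
  a j x := (1 / 2 : ℂ) * ∑ i, q i x * conj (dee j (q i) x)
  smooth j := contDiff_const.mul (ContDiff.sum fun i _ =>
    (hq i).1.mul (contDiff_conj (dee_contDiff (hq i).1 j)))
  closed j k x := by
    rw [dbar_half_sum fun i => (hq i).1.mul (contDiff_conj (dee_contDiff (hq i).1 k)),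
      dbar_half_sum fun i => (hq i).1.mul (contDiff_conj (dee_contDiff (hq i).1 j))]
    simp only [dbar_mul_conj (hq _) (dee_contDiff (hq _).1 _), dee_dee_comm (hq _).1 j k]
  pos x c := by
    have h1 : ∀ j k, dbar k (fun y => conj ((1 / 2 : ℂ) * ∑ i, q i y * conj (dee j (q i) y))) x =
        (1 / 2 : ℂ) * ∑ i, dee j (q i) x * conj (dee k (q i) x) := by
      intro j k
      have e : (fun y => conj ((1 / 2 : ℂ) * ∑ i, q i y * conj (dee j (q i) y))) =
          fun y => (1 / 2 : ℂ) * ∑ i, dee j (q i) y * conj (q i y) := by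
        funext y
        simp only [map_mul, map_sum, conj_conj, map_div₀, map_one, conj_ofNat, mul_comm]
      rw [e, dbar_half_sum fun i => (dee_contDiff (hq i).1 j).mul (contDiff_conj (hq i).1)]
      have hd : ∀ i, IsHolo (dee j (q i)) := fun i =>
        ⟨dee_contDiff (hq i).1 j, fun k x => dbar_dee_eq_zero (hq i) k j x⟩
      simp only [dbar_mul_conj (hd _) (hq _).1]
    have h2 : ∀ j k, dee j (fun y => (1 / 2 : ℂ) * ∑ i, q i y * conj (dee k (q i) y)) x =
        (1 / 2 : ℂ) * ∑ i, dee j (q i) x * conj (dee k (q i) x) := by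
      intro j k
      rw [dee_half_sum fun i => (hq i).1.mul (contDiff_conj (dee_contDiff (hq i).1 k))]
      congr 1
      refine Finset.sum_congr rfl fun i _ => ?_
      rw [dee_mul (hq i).1 (contDiff_conj (dee_contDiff (hq i).1 k)),
        dee_conj (dee_contDiff (hq i).1 k), dbar_dee_eq_zero (hq i)]
      simp
    refine (hpos x c).trans (le_of_eq ?_)
    have e : ∀ i, ‖∑ j, dee j (q i) x * c j‖ ^ 2 =
        (∑ j, ∑ k, dee j (q i) x * conj (dee k (q i) x) * c j * conj (c k)).re := fun i => by
      rw [← ofReal_re (‖_‖ ^ 2), ofReal_pow, ← mul_conj', map_sum, Finset.sum_mul_sum]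
      congr 1
      refine Finset.sum_congr rfl fun j _ => Finset.sum_congr rfl fun k _ => ?_
      rw [map_mul]; ring
    simp only [e, h1, h2, ← re_sum]
    rw [Finset.sum_comm]
    congr 1
    refine Finset.sum_congr rfl fun j _ => ?_
    rw [Finset.sum_comm]
    refine Finset.sum_congr rfl fun k _ => ?_
    rw [← mul_add, ← two_mul, ← mul_assoc, Finset.mul_sum, Finset.sum_mul, Finset.sum_mul]
    norm_num

/-- The exponent `∑ i, |q i|² / 2`. -/
def halfWeight (q : ι → (Fin n → ℂ) → ℂ) (x : Fin n → ℂ) : ℂ :=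
  (1 / 2 : ℂ) * ∑ i, q i x * conj (q i x)

lemma halfWeight_contDiff (hq : ∀ i, IsHolo (q i)) : ContDiff ℝ ∞ (halfWeight q) :=
  contDiff_const.mul (ContDiff.sum fun i _ => (hq i).1.mul (contDiff_conj (hq i).1))

lemma norm_cexp_neg_halfWeight (x : Fin n → ℂ) :
    ‖cexp (-halfWeight q x)‖ = Real.exp (-(∑ i, ‖q i x‖ ^ 2) / 2) := by
  rw [norm_exp, halfWeight]
  simp only [mul_conj']
  congr 1
  norm_cast
  rw [show (-(1 / 2 * ((∑ i, ‖q i x‖ ^ 2 : ℝ) : ℂ))) = ((-(∑ i, ‖q i x‖ ^ 2) / 2 : ℝ) : ℂ) by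
    push_cast; ring, ofReal_re]

/-- Hörmander's `L²` theorem for the weight `∑ i, |q i|²`, in the form of an approximation of
`u` by a weakly holomorphic function. -/
theorem exists_weak_holomorphic (hq : ∀ i, IsHolo (q i))
    (hpos : ∀ x (c : Fin n → ℂ), ∑ j, ‖c j‖ ^ 2 ≤ ∑ i, ‖∑ j, dee j (q i) x * c j‖ ^ 2)
    {u : (Fin n → ℂ) → ℂ} (hu : IsTest u) :
    ∃ H : (Fin n → ℂ) → ℂ, LocallyIntegrable H ∧
      (∀ ψ, IsTest ψ → ∀ j, ∫ x, H x * dbar j ψ x = 0) ∧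
      sqNorm (fun x => cexp (-halfWeight q x) * (u x - H x)) ≤
        ∑ j, sqNorm (fun x => cexp (-halfWeight q x) * dbar j u x) := by
  let W := holoWeight q hq hpos
  have hw := halfWeight_contDiff hq
  have hdw : ∀ j x, dbar j (halfWeight q) x = W.a j x := fun j x => by
    have : halfWeight q = fun x => (1 / 2 : ℂ) * ∑ i, q i x * conj (q i x) := rfl
    rw [this, dbar_half_sum fun i => (hq i).1.mul (contDiff_conj (hq i).1)]
    simp only [dbar_mul_conj (hq _) (hq _).1]
    rfl
  have hE : ContDiff ℝ ∞ fun x => cexp (-halfWeight q x) := hw.neg.cexp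
  have hE' : ContDiff ℝ ∞ fun x => cexp (halfWeight q x) := hw.cexp
  have hEE : ∀ x, cexp (-halfWeight q x) * cexp (halfWeight q x) = 1 := fun x => by
    rw [← Complex.exp_add]; simp
  obtain ⟨v, hv, hvw, hvn⟩ := exists_twisted_solution W (hu.smooth_mul hE)
  refine ⟨fun x => u x - cexp (halfWeight q x) * v x, ?_, fun ψ hψ j => ?_, ?_⟩
  · refine (hu.1.continuous.locallyIntegrable).sub ?_
    have := ((hv.locallyIntegrable (by norm_num)).locallyIntegrableOn Set.univ).continuousOn_mul
      hE'.continuous.continuousOn isOpen_univ.isLocallyClosed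
    exact locallyIntegrableOn_univ.1 this
  · have hψ' : IsTest fun x => conj (cexp (halfWeight q x) * ψ x) := (hψ.smooth_mul hE').conj
    have h := hvw _ hψ' j
    rw [← neg_eq_zero, ← integral_neg, ← h]
    refine integral_congr_ae (ae_of_all _ fun x => ?_)
    have hB : conj (W.B j (fun x => conj (cexp (halfWeight q x) * ψ x)) x) =
        - (cexp (halfWeight q x) * dbar j ψ x) := by
      rw [WeightCoeff.B, dee_conj (hψ.smooth_mul hE').1, map_sub, map_mul, conj_conj, conj_conj,
        conj_conj, dbar_mul hE' hψ.1, dbar_cexp hw, hdw]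
      ring
    have := hEE x
    simp only [hB]
    linear_combination (u x * dbar j ψ x) * this
  · have h1 : ∀ j, W.A j (fun x => cexp (-halfWeight q x) * u x) =
        fun x => cexp (-halfWeight q x) * dbar j u x := fun j => by
      funext x
      rw [WeightCoeff.A, dbar_mul hE hu.1, dbar_cexp hw.neg, dbar_neg, hdw]
      ring
    have h2 : (fun x => cexp (-halfWeight q x) * (u x - (u x - cexp (halfWeight q x) * v x))) =
        v := by
      funext x
      linear_combination v x * hEE x
    simp only [h1] at hvn
    rw [h2]
    exact hvn

end Weight

section Holomorphic

variable {n : ℕ} {F ρ f E : (Fin n → ℂ) → ℂ}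

lemma IsHolo.hasFDerivAt (hF : IsHolo F) (x : Fin n → ℂ) :
    HasFDerivAt F (∑ j, dee j F x • ContinuousLinearMap.proj (R := ℂ) (φ := fun _ : Fin n => ℂ) j)
      x := by
  refine hasFDerivAt_of_restrictScalars ℝ (hF.1.diffAt x).hasFDerivAt ?_
  ext v
  set L := fderiv ℝ F x with hL
  have h1 : ∀ j, dee j F x = L (Pi.single j 1) ∧
      L (Pi.single j I) = I * L (Pi.single j 1) := fun j => by
    have h := hF.2 j x
    rw [dbar, ← hL] at h
    have h' : L (Pi.single j 1) + I * L (Pi.single j I) = 0 := by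
      simpa using h
    constructor
    · rw [dee, ← hL]; linear_combination (1 / 2 : ℂ) * (-1 : ℂ) * h'
    · linear_combination (-I) * h' + L (Pi.single j I) * I_mul_I
  have h2 : ∀ j (c : ℂ), L (Pi.single j c) = dee j F x * c := fun j c => by
    have e : (Pi.single j c : Fin n → ℂ) = 
        c.re • (Pi.single j (1 : ℂ) : Fin n → ℂ) + c.im • (Pi.single j I : Fin n → ℂ) := by
      rw [← Pi.single_smul, ← Pi.single_smul, ← Pi.single_add]
      congr 1
      simp
    rw [e, map_add, map_smul, map_smul, (h1 j).2, (h1 j).1]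
    simp only [real_smul]
    conv_rhs => rw [← re_add_im c]
    ring
  have h3 : v = ∑ j, Pi.single j (v j) := (Finset.univ_sum_single v).symm
  conv_rhs => rw [h3, map_sum]
  simp [h2]

lemma IsHolo.hasDerivAt_line (hF : IsHolo F) (a z : Fin n → ℂ) (t : ℂ) :
    HasDerivAt (fun t : ℂ => F (a + t • z)) (∑ j, z j * dee j F (a + t • z)) t := by
  have h1 : HasDerivAt (fun t : ℂ => a + t • z) z t := by
    simpa using ((hasDerivAt_id t).smul_const z).const_add a
  have h2 := (hF.hasFDerivAt (a + t • z)).comp_hasDerivAt t h1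
  refine h2.congr_deriv ?_
  simp [mul_comm]

lemma IsHolo.dee (hF : IsHolo F) (j : Fin n) : IsHolo (dee j F) :=
  ⟨dee_contDiff hF.1 j, fun k x => dbar_dee_eq_zero hF k j x⟩

lemma IsHolo.differentiable_line (hF : IsHolo F) (a z : Fin n → ℂ) :
    Differentiable ℂ (fun t : ℂ => F (a + t • z)) := fun t =>
  (hF.hasDerivAt_line a z t).differentiableAt

lemma IsHolo.exists_iteratedDeriv_eq_eval (m : ℕ) : ∀ {F : (Fin n → ℂ) → ℂ}, IsHolo F →
    ∃ P : MvPolynomial (Fin n) ℂ, ∀ z,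
      iteratedDeriv m (fun t : ℂ => F (0 + t • z)) 0 = MvPolynomial.eval z P := by
  induction m with
  | zero => exact fun {F} _ => ⟨MvPolynomial.C (F 0), fun z => by simp⟩
  | succ m ih =>
    intro F hF
    choose P hP using fun j => ih (hF.dee j)
    refine ⟨∑ j, MvPolynomial.X j * P j, fun z => ?_⟩
    have hd : deriv (fun t : ℂ => F (0 + t • z)) =
        fun t => ∑ j, z j * _root_.dee j F (0 + t • z) :=
      funext fun t => (hF.hasDerivAt_line 0 z t).deriv
    have hs : ∀ j, ContDiffAt ℂ m (fun t : ℂ => _root_.dee j F (0 + t • z)) 0 := fun j =>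
      ((hF.dee j).differentiable_line 0 z).contDiff.contDiffAt
    rw [iteratedDeriv_succ', hd, iteratedDeriv_fun_sum fun j _ => contDiffAt_const.mul (hs j)]
    simp only [map_sum, map_mul, MvPolynomial.eval_X, ← hP]
    refine Finset.sum_congr rfl fun j _ => ?_
    exact iteratedDeriv_const_mul_field _ _

/-- Entire functions are uniform limits of polynomials on compact sets. -/
lemma IsHolo.exists_polynomial_approx (hF : IsHolo F) {S : Set (Fin n → ℂ)} (hS : IsCompact S)
    {ε : ℝ} (hε : 0 < ε) :
    ∃ P : MvPolynomial (Fin n) ℂ, ∀ x ∈ S, ‖F x - MvPolynomial.eval x P‖ ≤ ε := by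
  choose P hP using fun m => hF.exists_iteratedDeriv_eq_eval m
  let c : ℕ → (Fin n → ℂ) → ℂ := fun m x => ((m.factorial : ℂ)⁻¹) * MvPolynomial.eval x (P m)
  obtain ⟨M, hM⟩ : ∃ M, ∀ t ∈ Metric.sphere (0 : ℂ) 2, ∀ x ∈ S, ‖F (0 + t • x)‖ ≤ M := by
    obtain ⟨M, hM⟩ := ((isCompact_sphere (0 : ℂ) 2).prod hS).exists_bound_of_continuousOn
      (f := fun p : ℂ × (Fin n → ℂ) => F (0 + p.1 • p.2))
      (hF.1.continuous.comp (by fun_prop)).continuousOn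
    exact ⟨M, fun t ht x hx => hM (t, x) ⟨ht, hx⟩⟩
  have hc : ∀ m, ∀ x ∈ S, ‖c m x‖ ≤ M * (1 / 2) ^ m := fun m x hx => by
    have h := norm_iteratedDeriv_le_of_forall_mem_sphere_norm_le m (c := 0) (R := 2) two_pos
      (hF.differentiable_line 0 x).diffContOnCl fun t ht => hM t ht x hx
    rw [hP] at h
    simp only [c, norm_mul, norm_inv, norm_natCast]
    have hm : (0 : ℝ) < m.factorial := by positivity
    rw [inv_mul_le_iff₀ hm]
    refine h.trans (le_of_eq ?_)
    simp [div_eq_mul_inv]; ring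
  have hu := tendstoUniformlyOn_tsum_nat
    ((summable_geometric_of_lt_one (by norm_num) (by norm_num : (1 / 2 : ℝ) < 1)).mul_left M) hc
  have hsum : ∀ x, ∑' m, c m x = F x := fun x => by
    have h := taylorSeries_eq_of_entire' 0 1 (hF.differentiable_line 0 x)
    simp only [hP] at h
    simpa [c] using h
  obtain ⟨N, hN⟩ := (Metric.tendstoUniformlyOn_iff.1 hu ε hε).exists
  refine ⟨∑ m ∈ Finset.range N, MvPolynomial.C ((m.factorial : ℂ)⁻¹) * P m, fun x hx => ?_⟩
  have := (hN x hx).le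
  rw [hsum, dist_eq_norm] at this
  simpa [c] using this

lemma norm_le_of_mem_polyHull (hF : IsHolo F) {K : Set (Fin n → ℂ)} (hK : IsCompact K)
    (hne : K.Nonempty) {z : Fin n → ℂ} (hz : z ∈ polyHull n K) {M : ℝ}
    (hM : ∀ x ∈ K, ‖F x‖ ≤ M) : ‖F z‖ ≤ M := by
  refine le_of_forall_pos_le_add fun ε hε => ?_
  obtain ⟨P, hP⟩ := hF.exists_polynomial_approx (hK.insert z) (half_pos hε)
  have h1 : ‖MvPolynomial.eval z P‖ ≤ M + ε / 2 := by
    refine (hz P).trans (csSup_le (hne.image _) ?_)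
    rintro _ ⟨w, hw, rfl⟩
    have := hP w (Set.mem_insert_of_mem _ hw)
    have h2 := norm_sub_norm_le (MvPolynomial.eval w P) (F w)
    rw [norm_sub_rev] at h2
    have := hM w hw
    dsimp only
    linarith
  have h2 := hP z (Set.mem_insert _ _)
  have h3 := norm_sub_norm_le (F z) (MvPolynomial.eval z P)
  linarith

/-- Mollifications of weakly holomorphic functions are holomorphic. -/
lemma isHolo_conv {H : (Fin n → ℂ) → ℂ} (hρ : IsTest ρ) (hH : LocallyIntegrable H)
    (hw : ∀ ψ, IsTest ψ → ∀ j, ∫ x, H x * dbar j ψ x = 0) : IsHolo (conv ρ H) := by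
  refine ⟨conv_contDiff hρ hH, fun j x => ?_⟩
  have h := hw _ (translate_isTest hρ x) j
  simp only [dbar_translate hρ, mul_neg, integral_neg, neg_eq_zero] at h
  rw [dbar_conv hρ hH]
  exact h

/-- Pointwise bounds for mollifications in terms of a weighted norm. -/
lemma enorm_conv_sq_le (hρ : Continuous ρ) (hf : AEStronglyMeasurable f volume)
    (hE : Continuous E) {c : ℝ≥0∞} (hc : c ≠ ⊤) {x : Fin n → ℂ}
    (h : ∀ y, ρ (x - y) ≠ 0 → 1 ≤ c * ‖E y‖ₑ) :
    ‖conv ρ f x‖ₑ ^ 2 ≤ c ^ 2 * (sqNorm (fun y => E y * f y) * sqNorm ρ) := by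
  have hm1 : AEMeasurable (fun y => ‖E y * f y‖ₑ ^ 2) volume :=
    (hE.aestronglyMeasurable.mul hf).enorm.pow_const 2
  have hm2 : AEMeasurable (fun y => ‖ρ (x - y)‖ₑ ^ 2) volume :=
    ((hρ.comp (continuous_const.sub continuous_id)).enorm.aemeasurable).pow_const 2
  have hsq : ∀ t : ℝ≥0∞, (t ^ (1 / 2 : ℝ)) ^ 2 = t := fun t => by
    rw [← ENNReal.rpow_natCast, ← ENNReal.rpow_mul]; norm_num
  have hsq' : ∀ t : ℝ≥0∞, (t ^ 2) ^ (1 / 2 : ℝ) = t := fun t => by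
    rw [← ENNReal.rpow_natCast, ← ENNReal.rpow_mul]; norm_num
  have hCS := ENNReal.lintegral_mul_norm_pow_le hm1 hm2 (p := 1 / 2) (q := 1 / 2)
    (by norm_num) (by norm_num) (by norm_num)
  simp only [hsq'] at hCS
  have h1 : absConv ρ f x ≤ c * ∫⁻ y, ‖E y * f y‖ₑ * ‖ρ (x - y)‖ₑ := by
    rw [← lintegral_const_mul' _ _ hc]
    refine lintegral_mono fun y => ?_
    by_cases h0 : ρ (x - y) = 0
    · simp [h0]
    · calc ‖f y‖ₑ * ‖ρ (x - y)‖ₑ = 1 * (‖f y‖ₑ * ‖ρ (x - y)‖ₑ) := (one_mul _).symm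
        _ ≤ (c * ‖E y‖ₑ) * (‖f y‖ₑ * ‖ρ (x - y)‖ₑ) := by gcongr; exact h y h0
        _ = _ := by rw [enorm_mul]; ring
  have h2 : ∫⁻ y, ‖ρ (x - y)‖ₑ ^ 2 = sqNorm ρ :=
    lintegral_sub_left_eq_self (fun y => ‖ρ y‖ₑ ^ 2) x
  rw [h2] at hCS
  calc ‖conv ρ f x‖ₑ ^ 2 ≤ (c * ((sqNorm fun y => E y * f y) ^ (1 / 2 : ℝ) *
        sqNorm ρ ^ (1 / 2 : ℝ))) ^ 2 := by
        gcongr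
        refine (enorm_conv_le x).trans (h1.trans ?_)
        gcongr
        exact hCS
    _ = _ := by rw [mul_pow, mul_pow, hsq, hsq]

end Holomorphic

section MeanValue

variable {n : ℕ} {F ρ : (Fin n → ℂ) → ℂ}

lemma measurePreserving_rotation {c : ℂ} (hc : ‖c‖ = 1) :
    MeasurePreserving (fun y : Fin n → ℂ => c • y) := by
  have h : MeasurePreserving (fun z : ℂ => c * z) :=
    (rotation ⟨c, mem_sphere_zero_iff_norm.2 hc⟩).measurePreserving
  exact volume_preserving_pi (f := fun _ z => c * z) fun _ => h

lemma integral_comp_rotation (g : (Fin n → ℂ) → ℂ) {c : ℂ} (hc : ‖c‖ = 1) :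
    ∫ y, g (c • y) = ∫ y, g y := by
  have hc0 : c ≠ 0 := fun h => by simp [h] at hc
  exact (measurePreserving_rotation hc).integral_comp
    (Homeomorph.smulOfNeZero c hc0).measurableEmbedding g

/-- A smooth rotation invariant kernel supported in a small ball. -/
lemma exists_radial_kernel (n : ℕ) {ε : ℝ} (hε : 0 < ε) :
    ∃ ρ : (Fin n → ℂ) → ℂ, IsTest ρ ∧ (∀ y, ρ y ≠ 0 → ‖y‖ < ε) ∧
      (∀ (c : ℂ) y, ‖c‖ = 1 → ρ (c • y) = ρ y) ∧ ∫ y, ρ y ≠ 0 := by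
  let b : ContDiffBump (0 : ℝ) := ⟨ε ^ 2 / 2, ε ^ 2, by positivity, by nlinarith [sq_pos_of_pos hε]⟩
  let r : (Fin n → ℂ) → ℝ := fun y => ∑ j, normSq (y j)
  have hr : ContDiff ℝ ∞ r := by
    have : r = fun y => ∑ j, ((y j).re * (y j).re + (y j).im * (y j).im) := by
      funext y; simp [r, normSq_apply]
    rw [this]
    refine ContDiff.sum fun j _ => ?_
    have h1 : ContDiff ℝ ∞ fun y : Fin n → ℂ => (y j).re :=
      reCLM.contDiff.comp (contDiff_apply ℝ ℂ j)
    have h2 : ContDiff ℝ ∞ fun y : Fin n → ℂ => (y j).im :=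
      imCLM.contDiff.comp (contDiff_apply ℝ ℂ j)
    exact (h1.mul h1).add (h2.mul h2)
  have hsm : ContDiff ℝ ∞ fun y => b (r y) := b.contDiff.comp hr
  have hlt : ∀ y, b (r y) ≠ 0 → ‖y‖ < ε := fun y hy => by
    have h1 : r y ∈ Metric.ball (0 : ℝ) (ε ^ 2) := by
      have : r y ∈ Function.support b := hy
      rwa [b.support_eq] at this
    rw [mem_ball_zero_iff, Real.norm_eq_abs] at h1
    have h2 := (le_abs_self _).trans_lt h1
    refine (pi_norm_lt_iff hε).2 fun j => ?_
    have h3 : normSq (y j) ≤ r y :=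
      Finset.single_le_sum (f := fun j => normSq (y j)) (fun _ _ => normSq_nonneg _)
        (Finset.mem_univ j)
    rw [normSq_eq_norm_sq] at h3
    exact lt_of_pow_lt_pow_left₀ 2 hε.le (h3.trans_lt h2)
  have hcs : HasCompactSupport fun y => b (r y) := by
    refine HasCompactSupport.of_support_subset_isCompact
      (isCompact_closedBall (0 : Fin n → ℂ) ε) fun y hy => ?_
    exact mem_closedBall_zero_iff.2 (hlt y hy).le
  refine ⟨fun y => (b (r y) : ℂ), ⟨ofRealCLM.contDiff.comp hsm, hcs.comp_left (g := ofReal) rfl⟩,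
    fun y hy => hlt y (by simpa using hy), fun c y hc => ?_, ?_⟩
  · have : r (c • y) = r y := by
      simp [r, normSq_eq_norm_sq, hc]
    simp only [this]
  · rw [integral_complex_ofReal, ofReal_ne_zero]
    refine (hsm.continuous.integral_pos_of_hasCompactSupport_nonneg_nonzero hcs
      (fun y => b.nonneg) (x := 0) ?_).ne'
    have : r 0 = 0 := by simp [r]
    simp only [this]
    rw [b.one_of_mem_closedBall (Metric.mem_closedBall_self b.rIn_pos.le)]
    exact one_ne_zero

lemma IsHolo.intervalIntegral_rotation (hF : IsHolo F) (a y : Fin n → ℂ) :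
    ∫ θ in (0 : ℝ)..2 * Real.pi, F (a - cexp (θ * I) • y) = (2 * Real.pi) * F a := by
  have h := ((hF.differentiable_line a (-y)).diffContOnCl (s := Metric.ball 0 |1|)).circleAverage
  rw [Real.circleAverage_def] at h
  simp only [circleMap, ofReal_one, one_mul, zero_add, smul_neg, zero_smul, neg_zero,
    add_zero, ← sub_eq_add_neg, real_smul] at h
  have hpi : (Real.pi : ℂ) ≠ 0 := by exact_mod_cast Real.pi_ne_zero
  rw [← h, ← mul_assoc]
  push_cast
  rw [mul_inv_cancel₀ (mul_ne_zero two_ne_zero hpi), one_mul]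

/-- The mean value property with respect to a rotation invariant kernel. -/
lemma IsHolo.conv_eq (hF : IsHolo F) (hρ : IsTest ρ) (hrot : ∀ (c : ℂ) y, ‖c‖ = 1 → ρ (c • y) = ρ y)
    (a : Fin n → ℂ) : conv ρ F a = F a * ∫ y, ρ y := by
  have h0 : conv ρ F a = ∫ y, F (a - y) * ρ y := by
    rw [conv, ← integral_sub_left_eq_self (fun y => F (a - y) * ρ y) volume a]
    simp
  have hpi : (2 * Real.pi : ℂ) ≠ 0 := by exact_mod_cast Real.two_pi_pos.ne'
  have h1 : ∀ θ : ℝ, ∫ y, F (a - cexp (θ * I) • y) * ρ y = conv ρ F a := fun θ => by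
    rw [h0, ← integral_comp_rotation (fun y => F (a - y) * ρ y) (norm_exp_ofReal_mul_I θ)]
    simp only [hrot _ _ (norm_exp_ofReal_mul_I θ)]
  have hcont : Continuous fun p : ℝ × (Fin n → ℂ) => F (a - cexp (p.1 * I) • p.2) :=
    hF.1.continuous.comp (by fun_prop)
  obtain ⟨M, hM⟩ := ((isCompact_Icc (a := (0 : ℝ)) (b := 2 * Real.pi)).prod
    hρ.2).exists_bound_of_continuousOn hcont.continuousOn
  have hint : Integrable (fun p : ℝ × (Fin n → ℂ) => F (a - cexp (p.1 * I) • p.2) * ρ p.2)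
      ((volume.restrict (Set.uIoc 0 (2 * Real.pi))).prod volume) := by
    rw [Set.uIoc_of_le Real.two_pi_pos.le]
    have hg : Integrable (fun p : ℝ × (Fin n → ℂ) => M * ‖ρ p.2‖)
        ((volume.restrict (Set.Ioc 0 (2 * Real.pi))).prod volume) :=
      (Integrable.mul_prod (integrable_const M) hρ.integrable.norm)
    refine hg.mono' ((hcont.mul (hρ.1.continuous.comp continuous_snd)).aestronglyMeasurable) ?_
    have hae : ∀ᵐ p ∂((volume.restrict (Set.Ioc 0 (2 * Real.pi))).prod
        (volume : Measure (Fin n → ℂ))), p.1 ∈ Set.Ioc 0 (2 * Real.pi) :=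
      Measure.quasiMeasurePreserving_fst.ae (ae_restrict_mem measurableSet_Ioc)
    filter_upwards [hae] with p hp
    rw [norm_mul]
    by_cases h : ρ p.2 = 0
    · simp [h]
    · gcongr
      exact hM p ⟨Set.Ioc_subset_Icc_self hp, subset_tsupport _ h⟩
  have h2 := intervalIntegral_integral_swap
    (f := fun (θ : ℝ) (y : Fin n → ℂ) => F (a - cexp (θ * I) • y) * ρ y) hint
  simp only [h1, intervalIntegral.integral_const, intervalIntegral.integral_mul_const,
    hF.intervalIntegral_rotation, sub_zero, integral_const_mul, real_smul] at h2
  push_cast at h2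
  refine mul_left_cancel₀ hpi ?_
  rw [h2]; ring

end MeanValue

section HolomorphicPolynomials

variable {n : ℕ} {F G : (Fin n → ℂ) → ℂ}

lemma isHolo_const (c : ℂ) : IsHolo fun _ : Fin n → ℂ => c :=
  ⟨contDiff_const, fun j _ => dbar_const c j⟩

lemma fderiv_coord (i : Fin n) (x v : Fin n → ℂ) :
    fderiv ℝ (fun y : Fin n → ℂ => y i) x v = v i := by
  have h : HasFDerivAt (fun y : Fin n → ℂ => y i)
      (ContinuousLinearMap.proj (R := ℝ) (φ := fun _ : Fin n => ℂ) i) x :=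
    (ContinuousLinearMap.proj (R := ℝ) (φ := fun _ : Fin n => ℂ) i).hasFDerivAt
  rw [h.fderiv]
  rfl

lemma isHolo_coord (i : Fin n) : IsHolo fun x : Fin n → ℂ => x i := by
  refine ⟨contDiff_apply ℝ ℂ i, fun j x => ?_⟩
  rw [dbar, fderiv_coord, fderiv_coord]
  rcases eq_or_ne i j with rfl | h
  · simp
  · simp [h]

lemma dee_coord (i j : Fin n) (x : Fin n → ℂ) :
    dee j (fun x => x i) x = if i = j then 1 else 0 := by
  rw [dee, fderiv_coord, fderiv_coord]
  rcases eq_or_ne i j with rfl | h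
  · simp
    norm_num
  · simp [h]

lemma IsHolo.add (hF : IsHolo F) (hG : IsHolo G) : IsHolo fun x => F x + G x :=
  ⟨hF.1.add hG.1, fun j x => by rw [dbar_add hF.1 hG.1, hF.2, hG.2, add_zero]⟩

lemma IsHolo.mul (hF : IsHolo F) (hG : IsHolo G) : IsHolo fun x => F x * G x :=
  ⟨hF.1.mul hG.1, fun j x => by rw [dbar_mul hF.1 hG.1, hF.2, hG.2]; simp⟩

lemma IsHolo.pow (hF : IsHolo F) (k : ℕ) : IsHolo fun x => F x ^ k := by
  induction k with
  | zero => simpa using isHolo_const 1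
  | succ k ih => simpa only [pow_succ] using ih.mul hF

lemma isHolo_eval (P : MvPolynomial (Fin n) ℂ) : IsHolo fun x => MvPolynomial.eval x P := by
  induction P using MvPolynomial.induction_on with
  | C a => simpa using isHolo_const a
  | add p q hp hq => simpa using hp.add hq
  | mul_X p i hp => simpa using hp.mul (isHolo_coord i)

end HolomorphicPolynomials

section Hull

variable {n : ℕ} {K : Set (Fin n → ℂ)}

lemma nonempty_of_mem_polyHull {z : Fin n → ℂ} (hz : z ∈ polyHull n K) : K.Nonempty := by
  by_contra h
  rw [Set.not_nonempty_iff_eq_empty] at h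
  have := hz 1
  simp [h] at this
  linarith

lemma subset_polyHull (hK : IsCompact K) : K ⊆ polyHull n K := fun z hz P =>
  le_csSup (hK.image (MvPolynomial.continuous_eval P).norm).bddAbove ⟨z, hz, rfl⟩

lemma isClosed_polyHull : IsClosed (polyHull n K) := by
  rw [polyHull, Set.ofPred_forall]
  exact isClosed_iInter fun P =>
    isClosed_le (MvPolynomial.continuous_eval P).norm continuous_const

/-- Points outside the hull are separated from the set by an entire function. -/
lemma exists_isHolo_of_notMem_polyHull (hK : IsCompact K) {z : Fin n → ℂ}
    (hz : z ∉ polyHull n K) : ∃ p, IsHolo p ∧ 1 < ‖p z‖ ∧ ∀ x ∈ K, ‖p x‖ < 1 := by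
  simp only [polyHull, Set.mem_ofPred_eq, not_forall, not_le] at hz
  obtain ⟨P, hP⟩ := hz
  obtain ⟨r, hr1, hr2⟩ := exists_between hP
  have h0 : 0 ≤ sSup ((fun w => ‖MvPolynomial.eval w P‖) '' K) :=
    Real.sSup_nonneg (by rintro _ ⟨w, -, rfl⟩; exact norm_nonneg _)
  have hr : 0 < r := h0.trans_lt hr1
  have hn : ∀ x, ‖(r : ℂ)⁻¹ * MvPolynomial.eval x P‖ = ‖MvPolynomial.eval x P‖ / r := fun x => by
    rw [norm_mul, norm_inv, norm_real, Real.norm_of_nonneg hr.le, div_eq_inv_mul]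
  refine ⟨fun x => (r : ℂ)⁻¹ * MvPolynomial.eval x P, (isHolo_const _).mul (isHolo_eval P),
    ?_, fun x hx => ?_⟩
  · rw [hn, one_lt_div hr]; exact hr2
  · rw [hn, div_lt_one hr]
    exact (le_csSup (hK.image (MvPolynomial.continuous_eval P).norm).bddAbove
      ⟨x, hx, rfl⟩).trans_lt hr1

lemma isCompact_polyHull : IsCompact (polyHull n K) := by
  refine (isCompact_univ_pi fun i => isCompact_closedBall (0 : ℂ)
    (sSup ((fun w => ‖MvPolynomial.eval w (MvPolynomial.X i)‖) '' K))).of_isClosed_subset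
    isClosed_polyHull fun z hz i _ => ?_
  simpa using hz (MvPolynomial.X i)

end Hull

section Cutoff

variable {n : ℕ}

lemma exists_isTest_one_zero {F K : Set (Fin n → ℂ)} (hF : IsCompact F) (hK : IsCompact K)
    (hd : Disjoint F K) : ∃ χ : (Fin n → ℂ) → ℂ, IsTest χ ∧ (∀ᶠ x in 𝓝ˢ F, χ x = 1) ∧
      ∀ᶠ x in 𝓝ˢ K, χ x = 0 := by
  obtain ⟨R, hR⟩ := hF.isBounded.subset_ball 0
  obtain ⟨f, h0, h1, -⟩ := exists_contMDiffMap_zero_one_nhds_of_isClosed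
    (modelWithCornersSelf ℝ (Fin n → ℂ)) (n := ⊤)
    (s := K ∪ (Metric.ball 0 R)ᶜ) (t := F)
    (hK.isClosed.union Metric.isOpen_ball.isClosed_compl) hF.isClosed
    (Set.disjoint_union_left.2 ⟨hd.symm, Set.disjoint_compl_left_iff_subset.2 hR⟩)
  have hf : ContDiff ℝ ∞ f := f.contMDiff.contDiff
  refine ⟨fun x => (f x : ℂ), ⟨ofRealCLM.contDiff.comp hf, ?_⟩, ?_, ?_⟩
  · refine HasCompactSupport.of_support_subset_isCompact
      (isCompact_closedBall (0 : Fin n → ℂ) R) fun x hx => ?_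
    by_contra h
    refine hx ?_
    have := h0.self_of_nhdsSet x (Or.inr fun h' => h (Metric.ball_subset_closedBall h'))
    simp [this]
  · filter_upwards [h1] with x hx
    simp [hx]
  · filter_upwards [nhdsSet_mono Set.subset_union_left h0] with x hx
    simp [hx]

end Cutoff

section MaximumPrinciple

variable {n : ℕ} {ι : Type*} [Fintype ι]

/-- High powers of finitely many functions dominate `P ^ N` wherever `P` is large, as soon as one
of them exceeds `1` there. -/
lemma exists_pow_weight_le {S : Set (Fin n → ℂ)} (hS : IsCompact S) {P : (Fin n → ℂ) → ℂ}
    (hP : Continuous P) {p : ι → (Fin n → ℂ) → ℂ} (hp : ∀ i, Continuous (p i))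
    (h : ∀ x ∈ S, ‖P x‖ < 1 ∨ ∃ i, 1 < ‖p i x‖) (N : ℕ) :
    ∃ k : ℕ, ∀ x ∈ S, ‖P x‖ ^ N * Real.exp (-(∑ i, ‖p i x ^ k‖ ^ 2) / 2) ≤ 1 := by
  have hexp : ∀ (k : ℕ) x, Real.exp (-(∑ i, ‖p i x ^ k‖ ^ 2) / 2) ≤ 1 := fun k x => by
    rw [Real.exp_le_one_iff]
    have : 0 ≤ ∑ i, ‖p i x ^ k‖ ^ 2 := Finset.sum_nonneg fun i _ => by positivity
    linarith
  have hsmall : ∀ (k : ℕ) x, ‖P x‖ < 1 →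
      ‖P x‖ ^ N * Real.exp (-(∑ i, ‖p i x ^ k‖ ^ 2) / 2) ≤ 1 := fun k x hx =>
    mul_le_one₀ (pow_le_one₀ (norm_nonneg _) hx.le) (Real.exp_nonneg _) (hexp k x)
  have hT : IsCompact (S ∩ {x | 1 ≤ ‖P x‖}) :=
    hS.inter_right (isClosed_le continuous_const hP.norm)
  rcases (S ∩ {x | 1 ≤ ‖P x‖}).eq_empty_or_nonempty with hE | hE
  · refine ⟨0, fun x hx => hsmall 0 x ?_⟩
    by_contra! h1
    exact (hE ▸ (⟨hx, h1⟩ : x ∈ S ∩ {x | 1 ≤ ‖P x‖}) : x ∈ (∅ : Set (Fin n → ℂ)))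
  obtain ⟨y, hy, hmin⟩ := hT.exists_isMinOn hE
    (f := fun x => ‖fun i => p i x‖) (continuous_pi hp).norm.continuousOn
  set θ := ‖fun i => p i y‖ with hθ
  have hθ1 : 1 < θ := by
    rcases h y hy.1 with h1 | ⟨i, hi⟩
    · exact absurd hy.2 (not_le.2 h1)
    · exact hi.trans_le (norm_le_pi_norm (fun i => p i y) i)
  obtain ⟨M, hM⟩ := hS.exists_bound_of_continuousOn hP.continuousOn
  have hM1 : 1 ≤ M := le_trans hy.2 (hM y hy.1)
  obtain ⟨k, hk⟩ := pow_unbounded_of_one_lt (2 * Real.log (M ^ N)) hθ1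
  refine ⟨k, fun x hx => ?_⟩
  by_cases h1 : ‖P x‖ < 1
  · exact hsmall k x h1
  have hxθ : θ ≤ ‖fun i => p i x‖ := hmin ⟨hx, not_lt.1 h1⟩
  obtain ⟨i, hi⟩ : ∃ i, θ ≤ ‖p i x‖ := by
    by_contra! hlt
    exact absurd ((pi_norm_lt_iff (zero_lt_one.trans hθ1)).2 hlt) (not_lt.2 hxθ)
  have hpow : θ ^ k ≤ ∑ i, ‖p i x ^ k‖ ^ 2 := calc
    θ ^ k ≤ (θ ^ k) ^ 2 := le_self_pow₀ (one_le_pow₀ hθ1.le) two_ne_zero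
    _ ≤ ‖p i x ^ k‖ ^ 2 := by rw [norm_pow]; gcongr
    _ ≤ _ := Finset.single_le_sum (f := fun i => ‖p i x ^ k‖ ^ 2) (fun _ _ => by positivity)
      (Finset.mem_univ i)
  have hMN : 0 < M ^ N := by positivity
  calc ‖P x‖ ^ N * Real.exp (-(∑ i, ‖p i x ^ k‖ ^ 2) / 2)
      ≤ M ^ N * Real.exp (-Real.log (M ^ N)) := by
        gcongr
        · exact hM x hx
        · linarith
    _ = 1 := by rw [Real.exp_neg, Real.exp_log hMN, mul_inv_cancel₀ hMN.ne']

lemma coord_sum_le {p : ι → (Fin n → ℂ) → ℂ} (x c : Fin n → ℂ) :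
    ∑ j, ‖c j‖ ^ 2 ≤ ∑ i, ‖∑ j, dee j (Sum.elim (fun (i : Fin n) (x : Fin n → ℂ) => x i) p i) x *
      c j‖ ^ 2 := by
  rw [Fintype.sum_sum_type]
  simp only [Sum.elim_inl, Sum.elim_inr, dee_coord, ite_mul, one_mul, zero_mul,
    Finset.sum_ite_eq, Finset.mem_univ, if_true]
  exact le_add_of_nonneg_right (Finset.sum_nonneg fun i _ => by positivity)

lemma sqNorm_ne_top {f : (Fin n → ℂ) → ℂ} (hf : IsTest f) : sqNorm f ≠ ⊤ := by
  rw [sqNorm_eq_ofReal hf]; exact ENNReal.ofReal_ne_top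

lemma sqNorm_mono {f g : (Fin n → ℂ) → ℂ} (h : ∀ x, ‖f x‖ ≤ ‖g x‖) : sqNorm f ≤ sqNorm g := by
  refine lintegral_mono fun x => ?_
  gcongr
  exact enorm_le_iff_norm_le.2 (h x)

/-- A local maximum principle: an entire function which is small, or dominated by functions that
are small on `K`, on the transition region of a cutoff between `K` and a point `z` of its hull
cannot be large at `z`. -/
theorem norm_le_one_of_cutoff {K : Set (Fin n → ℂ)} (hK : IsCompact K) {z : Fin n → ℂ}
    (hz : z ∈ polyHull n K) {P : (Fin n → ℂ) → ℂ} (hP : IsHolo P)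
    {p : ι → (Fin n → ℂ) → ℂ} (hp : ∀ i, IsHolo (p i)) (hpK : ∀ i, ∀ x ∈ K, ‖p i x‖ < 1)
    {χ : (Fin n → ℂ) → ℂ} (hχ : IsTest χ) (hχz : ∀ᶠ x in 𝓝 z, χ x = 1)
    (hχK : ∀ᶠ x in 𝓝ˢ K, χ x = 0) {S : Set (Fin n → ℂ)} (hS : IsCompact S)
    (hχS : ∀ x ∉ S, ∀ j, dbar j χ x = 0)
    (h : ∀ x ∈ S, ‖P x‖ < 1 ∨ ∃ i, 1 < ‖p i x‖) : ‖P z‖ ≤ 1 := by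
  have hne := nonempty_of_mem_polyHull hz
  have hK' : IsCompact (insert z K) := hK.insert z
  -- all the controlling functions are small near `K` and `z`
  have hpz : ∀ i, ∀ x ∈ insert z K, ‖p i x‖ < 1 := by
    rintro i x (rfl | hx)
    · obtain ⟨y, hy, hmax⟩ := hK.exists_isMaxOn hne (hp i).1.continuous.norm.continuousOn
      exact (norm_le_of_mem_polyHull (hp i) hK hne hz fun w hw => hmax hw).trans_lt (hpK i y hy)
    · exact hpK i x hx
  obtain ⟨ε₁, hε₁, h₁⟩ := hK'.exists_thickening_subset_open
    (t := ⋂ i, {x | ‖p i x‖ < 1})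
    (isOpen_iInter_of_finite fun i => isOpen_lt (hp i).1.continuous.norm continuous_const)
    (fun x hx => Set.mem_iInter.2 fun i => hpz i x hx)
  obtain ⟨V, hVo, hKV, hV⟩ := eventually_nhdsSet_iff_exists.1 hχK
  obtain ⟨ε₂, hε₂, h₂⟩ := hK.exists_thickening_subset_open hVo hKV
  obtain ⟨ε₃, hε₃, h₃⟩ := Metric.eventually_nhds_iff.1 hχz
  obtain ⟨ε, hε, hε'⟩ := exists_between (lt_min (lt_min hε₁ hε₂) (lt_min hε₃ one_pos))
  obtain ⟨hε1, hε2⟩ := lt_min_iff.1 hε'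
  obtain ⟨hε11, hε12⟩ := lt_min_iff.1 hε1
  obtain ⟨hε21, hε22⟩ := lt_min_iff.1 hε2
  obtain ⟨R, hR⟩ := hK'.isBounded.exists_norm_le
  obtain ⟨ρ, hρ, hρε, hrot, hint⟩ := exists_radial_kernel n hε
  have hnear : ∀ x y, ρ (x - y) ≠ 0 → dist y x < ε := fun x y hy => by
    rw [dist_comm, dist_eq_norm]; exact hρε _ hy
  -- a lower bound for the weights near `K` and `z`, independent of the exponent
  set L : ℝ := n * (R + 1) ^ 2 + Fintype.card ι with hL
  set c : ℝ≥0∞ := ENNReal.ofReal (Real.exp (L / 2)) with hc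
  have hweight : ∀ (k : ℕ), ∀ x ∈ insert z K, ∀ y, ρ (x - y) ≠ 0 →
      1 ≤ c * ‖cexp (-halfWeight (Sum.elim (fun (i : Fin n) (x : Fin n → ℂ) => x i)
        (fun i x => p i x ^ k)) y)‖ₑ := fun k x hx y hy => by
    have hxy := hnear x y hy
    have hyn : ‖y‖ ≤ R + 1 := by
      have h1 := norm_le_norm_add_norm_sub' y x
      rw [← dist_eq_norm] at h1
      have := hR x hx
      linarith
    have hyp : ∀ i, ‖p i y‖ < 1 := fun i => by
      have := h₁ (Metric.mem_thickening_iff.2 ⟨x, hx, hxy.trans hε11⟩)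
      exact Set.mem_iInter.1 this i
    rw [← ofReal_norm, norm_cexp_neg_halfWeight, hc,
      ← ENNReal.ofReal_mul (Real.exp_nonneg _), ← Real.exp_add, ← ENNReal.ofReal_one]
    refine ENNReal.ofReal_le_ofReal (Real.one_le_exp ?_)
    rw [Fintype.sum_sum_type]
    simp only [Sum.elim_inl, Sum.elim_inr]
    have e1 : ∑ j, ‖y j‖ ^ 2 ≤ n * (R + 1) ^ 2 := by
      refine (Finset.sum_le_sum fun j _ => pow_le_pow_left₀ (norm_nonneg _)
        ((norm_le_pi_norm y j).trans hyn) 2).trans ?_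
      simp
    have e2 : ∑ i, ‖p i y ^ k‖ ^ 2 ≤ Fintype.card ι := by
      refine (Finset.sum_le_sum fun i _ => ?_).trans (le_of_eq (by simp : ∑ _i : ι, (1 : ℝ) = _))
      rw [norm_pow]
      exact pow_le_one₀ (by positivity) (pow_le_one₀ (norm_nonneg _) (hyp i).le)
    linarith
  set D : ℝ≥0∞ := c ^ 2 * ((∑ j, sqNorm (dbar j χ)) * sqNorm ρ) with hD
  have hDtop : D ≠ ⊤ := ENNReal.mul_ne_top (ENNReal.pow_ne_top ENNReal.ofReal_ne_top)
    (ENNReal.mul_ne_top (ENNReal.sum_ne_top.2 fun j _ => sqNorm_ne_top (hχ.dbar j))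
      (sqNorm_ne_top hρ))
  -- the resulting bound is uniform in the power of `P`
  have hbound : ∀ N : ℕ, ‖P z‖ ^ N * ‖∫ y, ρ y‖ ≤ 2 * (D.toReal + 1) := fun N => by
    obtain ⟨k, hk⟩ := exists_pow_weight_le hS hP.1.continuous (fun i => (hp i).1.continuous) h N
    set q : Fin n ⊕ ι → (Fin n → ℂ) → ℂ :=
      Sum.elim (fun (i : Fin n) (x : Fin n → ℂ) => x i) (fun i x => p i x ^ k) with hqdef
    have hq : ∀ i, IsHolo (q i) := by
      rintro (i | i)
      · exact isHolo_coord i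
      · exact (hp i).pow k
    have hPN := hP.pow N
    have hu : IsTest fun x => P x ^ N * χ x := hχ.smooth_mul hPN.1
    obtain ⟨H, hH, hHw, hHn⟩ := exists_weak_holomorphic hq coord_sum_le hu
    have hle : ∑ j, sqNorm (fun x => cexp (-halfWeight q x) *
        dbar j (fun x => P x ^ N * χ x) x) ≤ ∑ j, sqNorm (dbar j χ) := by
      refine Finset.sum_le_sum fun j _ => sqNorm_mono fun x => ?_
      rw [dbar_mul hPN.1 hχ.1, hPN.2, zero_mul, zero_add]
      by_cases hx : x ∈ S
      · rw [norm_mul, norm_mul, ← mul_assoc, norm_cexp_neg_halfWeight, norm_pow]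
        refine mul_le_of_le_one_left (norm_nonneg _) ?_
        refine le_trans ?_ (hk x hx)
        rw [mul_comm]
        gcongr
        rw [Fintype.sum_sum_type]
        exact le_add_of_nonneg_left (Finset.sum_nonneg fun i _ => by positivity)
      · simp [hχS x hx j]
    have hconv : ∀ x ∈ insert z K,
        ‖conv ρ (fun x => P x ^ N * χ x) x - conv ρ H x‖ ≤ D.toReal + 1 := fun x hx => by
      have e : conv ρ (fun x => P x ^ N * χ x) x - conv ρ H x =
          conv ρ (fun x => P x ^ N * χ x - H x) x := by
        simp only [conv, sub_mul]
        exact (integral_sub (integrable_conv hρ.1.continuous hρ.2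
          hu.1.continuous.locallyIntegrable x)
          (integrable_conv hρ.1.continuous hρ.2 hH x)).symm
      have h1 := enorm_conv_sq_le (f := fun x => P x ^ N * χ x - H x) hρ.1.continuous
        (hu.1.continuous.aestronglyMeasurable.sub hH.aestronglyMeasurable)
        (halfWeight_contDiff hq).neg.cexp.continuous ENNReal.ofReal_ne_top (hweight k x hx)
      have h2 : ‖conv ρ (fun x => P x ^ N * χ x - H x) x‖ₑ ^ 2 ≤ D :=
        h1.trans (by rw [hD]; gcongr; exact hHn.trans hle)
      rw [e]
      have h3 := ENNReal.toReal_mono hDtop h2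
      rw [ENNReal.toReal_pow, toReal_enorm] at h3
      nlinarith [sq_nonneg (‖conv ρ (fun x => P x ^ N * χ x - H x) x‖ - 1)]
    have hKzero : ∀ x ∈ K, conv ρ (fun x => P x ^ N * χ x) x = 0 := fun x hx => by
      rw [conv, ← integral_zero (Fin n → ℂ) ℂ]
      congr 1
      funext y
      by_cases hy : ρ (x - y) = 0
      · simp [hy]
      · rw [hV y (h₂ (Metric.mem_thickening_iff.2 ⟨x, hx, (hnear x y hy).trans hε12⟩))]
        simp
    have hz1 : conv ρ (fun x => P x ^ N * χ x) z = P z ^ N * ∫ y, ρ y := by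
      rw [← hPN.conv_eq hρ hrot, conv, conv]
      congr 1
      funext y
      by_cases hy : ρ (z - y) = 0
      · simp [hy]
      · rw [h₃ ((hnear z y hy).trans hε21), mul_one]
    have hHz : ‖conv ρ H z‖ ≤ D.toReal + 1 := by
      refine norm_le_of_mem_polyHull (isHolo_conv hρ hH hHw) hK hne hz fun x hx => ?_
      have := hconv x (Or.inr hx)
      rwa [hKzero x hx, zero_sub, norm_neg] at this
    have h4 := hconv z (Or.inl rfl)
    rw [hz1] at h4
    have h5 := norm_le_norm_add_norm_sub' (P z ^ N * ∫ y, ρ y) (conv ρ H z)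
    rw [norm_mul, norm_pow] at h5
    linarith
  by_contra! hlt
  have hpos : 0 < ‖∫ y, ρ y‖ := norm_pos_iff.2 hint
  obtain ⟨N, hN⟩ := pow_unbounded_of_one_lt (2 * (D.toReal + 1) / ‖∫ y, ρ y‖) hlt
  rw [div_lt_iff₀ hpos] at hN
  exact absurd (hbound N) (not_le.2 hN)

end MaximumPrinciple

section CutoffSupport

variable {n : ℕ}

lemma notMem_tsupport_dbar {χ : (Fin n → ℂ) → ℂ} {x : Fin n → ℂ} {c : ℂ}
    (h : ∀ᶠ y in 𝓝 x, χ y = c) (j : Fin n) : x ∉ tsupport (dbar j χ) := by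
  rw [notMem_tsupport_iff_eventuallyEq]
  filter_upwards [h.eventually_nhds] with y hy
  have : fderiv ℝ χ y = 0 := by
    rw [EventuallyEq.fderiv_eq (f := fun _ => c) hy]; simp
  simp [dbar, this]

end CutoffSupport

/-- If `K ⊆ ℂⁿ` is compact and `Γ` is a compact polynomially convex set with
`trc(K) ⊆ Γ ⊆ K`, then `K` is polynomially convex. -/
theorem polyConvex_of_trc_subset_polyConvex (n : ℕ) (K Γ : Set (Fin n → ℂ))
    (hK : IsCompact K) (hΓ : IsCompact Γ) (hΓpc : polyHull n Γ = Γ)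
    (h₁ : trc n K ⊆ Γ) (h₂ : Γ ⊆ K) :
    polyHull n K = K := by
  refine (Set.Subset.antisymm (fun z hz => ?_) (subset_polyHull hK))
  by_contra hzK
  obtain ⟨P, hP, hPz, hPΓ⟩ := exists_isHolo_of_notMem_polyHull hΓ (z := z)
    (by rw [hΓpc]; exact fun h => hzK (h₂ h))
  have hEX : essHull n K ⊆ polyHull n K :=
    closure_minimal Set.sdiff_subset isClosed_polyHull
  set F := essHull n K ∩ {x | 1 ≤ ‖P x‖} with hF
  have hFc : IsCompact F := (isCompact_polyHull.of_isClosed_subset isClosed_closure hEX).inter_right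
    (isClosed_le continuous_const hP.1.continuous.norm)
  have hzF : z ∈ F := ⟨subset_closure ⟨hz, hzK⟩, hPz.le⟩
  have hFK : Disjoint F K := by
    rw [Set.disjoint_left]
    exact fun x hx hxK => absurd (hPΓ x (h₁ ⟨hx.1, hxK⟩)) (not_lt.2 hx.2)
  obtain ⟨χ, hχ, hχF, hχK⟩ := exists_isTest_one_zero hFc hK hFK
  rw [eventually_nhdsSet_iff_forall] at hχF
  have hχK' := eventually_nhdsSet_iff_forall.1 hχK
  set S := ⋃ j, tsupport (dbar j χ) with hS
  have hSc : IsCompact S := isCompact_iUnion fun j => (hχ.dbar j).2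
  have hSsep : ∀ x ∈ S, ‖P x‖ < 1 ∨ ∃ p, (IsHolo p ∧ ∀ y ∈ K, ‖p y‖ < 1) ∧ 1 < ‖p x‖ := by
    intro x hx
    obtain ⟨j, hj⟩ := Set.mem_iUnion.1 hx
    by_cases hxX : x ∈ polyHull n K
    · left
      by_contra hPx
      have hxK : x ∉ K := fun hxK => notMem_tsupport_dbar (hχK' x hxK) j hj
      exact notMem_tsupport_dbar
        (hχF x ⟨subset_closure ⟨hxX, hxK⟩, not_lt.1 hPx⟩) j hj
    · right
      obtain ⟨p, hp, hpx, hpK⟩ := exists_isHolo_of_notMem_polyHull hK hxX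
      exact ⟨p, ⟨hp, hpK⟩, hpx⟩
  obtain ⟨t, ht⟩ := (hSc.inter_right
      (isClosed_le continuous_const hP.1.continuous.norm :
        IsClosed {x | 1 ≤ ‖P x‖})).elim_finite_subcover
    (fun p : {p : (Fin n → ℂ) → ℂ // IsHolo p ∧ ∀ y ∈ K, ‖p y‖ < 1} => {x | 1 < ‖p.1 x‖})
    (fun p => isOpen_lt continuous_const p.2.1.1.continuous.norm) (by
      rintro x ⟨hx, hPx⟩
      obtain h | ⟨p, hp, hpx⟩ := hSsep x hx
      · exact absurd hPx (not_le.2 h)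
      · exact Set.mem_iUnion.2 ⟨⟨p, hp⟩, hpx⟩)
  refine absurd (norm_le_one_of_cutoff hK hz hP (ι := t) (p := fun i => i.1.1)
    (fun i => i.1.2.1) (fun i => i.1.2.2) hχ (hχF z hzF) hχK hSc (fun x hx j => ?_)
    fun x hx => ?_) (not_le.2 hPz)
  · exact image_eq_zero_of_notMem_tsupport fun h => hx (Set.mem_iUnion.2 ⟨j, h⟩)
  · refine (lt_or_ge ‖P x‖ 1).imp_right fun hPx => ?_
    obtain ⟨p, hpt, hpx⟩ := Set.mem_iUnion₂.1 (ht ⟨hx, hPx⟩)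
    exact ⟨⟨p, hpt⟩, hpx⟩
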